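/- arXiv:2512.20465 — 2 statements merged into one kernel-verified Lean document; each statement's English description precedes it below -/
import Mathlib

section
/- Let H be a Hopf algebra over k and B ⊆ A a right H-Galois extension with A faithfully flat as a left B-module. Let F: B → C be an algebra map and ψ: A⊗C → C⊗A a twisting map which is a right H-comodule morphism and such that \barψ = π_B∘ψ is a B-bimodule morphism satisfying \barψ(1_A⊗c) = c⊗_B1_A, \barψ(a⊗1_C) = 1_C⊗_Ba, and \barψ(a⊗cc') = c^ψ·\barψ(a^ψ⊗c'). Then the twisted push-forward algebra C⊗^ψ_BA is a right H-comodule algebra with coaction id_C⊗_Bδ whose coinvariant subalgebra is exactly C (embedded as c ↦ c⊗_B1_A), the extension C ⊆ C⊗^ψ_BA is H-Galois (its canonical map χ^ψ is bijective), and C⊗_BA is faithfully flat as a left C-module. -/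
open TensorProduct LinearMap Function

noncomputable section
namespace Paper

variable (k : Type*) [Field k]
section Twist
variable (A : Type*) [Ring A] [Algebra k A] (C : Type*) [Ring C] [Algebra k C]

/-- The twisted multiplication `m^ψ := (m_C ⊗ m_A) ∘ (id_C ⊗ ψ ⊗ id_A)` as a linear map
`(C ⊗ A) ⊗ (C ⊗ A) → C ⊗ A`. -/
def tmulMap (ψ : A ⊗[k] C →ₗ[k] C ⊗[k] A) :
    (C ⊗[k] A) ⊗[k] (C ⊗[k] A) →ₗ[k] C ⊗[k] A :=
  TensorProduct.map (LinearMap.mul' k C) (LinearMap.mul' k A)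
    ∘ₗ (TensorProduct.assoc k (C ⊗[k] C) A A).toLinearMap
    ∘ₗ TensorProduct.map (TensorProduct.assoc k C C A).symm.toLinearMap LinearMap.id
    ∘ₗ TensorProduct.map (LinearMap.lTensor C ψ) LinearMap.id
    ∘ₗ TensorProduct.map (TensorProduct.assoc k C A C).toLinearMap LinearMap.id
    ∘ₗ (TensorProduct.assoc k (C ⊗[k] A) C A).symm.toLinearMap

/-- The twisted product of two elements of `C ⊗ A`. -/
def tmul (ψ : A ⊗[k] C →ₗ[k] C ⊗[k] A) (x y : C ⊗[k] A) : C ⊗[k] A :=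
  tmulMap k A C ψ (x ⊗ₜ y)

/-- `ψ` is a twisting map when the product `m^ψ` is associative. -/
def IsTwistingMap (ψ : A ⊗[k] C →ₗ[k] C ⊗[k] A) : Prop :=
  ∀ x y z : C ⊗[k] A,
    tmul k A C ψ (tmul k A C ψ x y) z = tmul k A C ψ x (tmul k A C ψ y z)

/-- `ψ (a ⊗ 1_C) = 1_C ⊗ a`. -/
def LeftNormal (ψ : A ⊗[k] C →ₗ[k] C ⊗[k] A) : Prop :=
  ∀ a : A, ψ (a ⊗ₜ (1 : C)) = (1 : C) ⊗ₜ a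

/-- `ψ (1_A ⊗ c) = c ⊗ 1_A`. -/
def RightNormal (ψ : A ⊗[k] C →ₗ[k] C ⊗[k] A) : Prop :=
  ∀ c : C, ψ ((1 : A) ⊗ₜ c) = c ⊗ₜ (1 : A)

/-- Distributive law (C1): `ψ ∘ (m_A ⊗ id_C) = (id_C ⊗ m_A) ∘ (ψ ⊗ id_A) ∘ (id_A ⊗ ψ)`. -/
def DistLawC1 (ψ : A ⊗[k] C →ₗ[k] C ⊗[k] A) : Prop :=
  ψ ∘ₗ rTensor C (LinearMap.mul' k A)
    = lTensor C (LinearMap.mul' k A)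
        ∘ₗ (TensorProduct.assoc k C A A).toLinearMap
        ∘ₗ rTensor A ψ
        ∘ₗ (TensorProduct.assoc k A C A).symm.toLinearMap
        ∘ₗ lTensor A ψ
        ∘ₗ (TensorProduct.assoc k A A C).toLinearMap

/-- Distributive law (C2): `ψ ∘ (id_A ⊗ m_C) = (m_C ⊗ id_A) ∘ (id_C ⊗ ψ) ∘ (ψ ⊗ id_C)`. -/
def DistLawC2 (ψ : A ⊗[k] C →ₗ[k] C ⊗[k] A) : Prop :=
  ψ ∘ₗ lTensor A (LinearMap.mul' k C)
    = rTensor A (LinearMap.mul' k C)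
        ∘ₗ (TensorProduct.assoc k C C A).symm.toLinearMap
        ∘ₗ lTensor C ψ
        ∘ₗ (TensorProduct.assoc k C A C).toLinearMap
        ∘ₗ rTensor C ψ
        ∘ₗ (TensorProduct.assoc k A C C).symm.toLinearMap

/-- The left-hand side of the associativity condition (Oeq):
`(id_C ⊗ m_A) ∘ (ψ ⊗ id_A) ∘ (id_A ⊗ m_C ⊗ id_A) ∘ (id_A ⊗ id_C ⊗ ψ)`. -/
def OeqLHS (ψ : A ⊗[k] C →ₗ[k] C ⊗[k] A) :
    (A ⊗[k] C) ⊗[k] (A ⊗[k] C) →ₗ[k] C ⊗[k] A :=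
  lTensor C (LinearMap.mul' k A)
    ∘ₗ (TensorProduct.assoc k C A A).toLinearMap
    ∘ₗ rTensor A ψ
    ∘ₗ TensorProduct.map (lTensor A (LinearMap.mul' k C)) LinearMap.id
    ∘ₗ TensorProduct.map (TensorProduct.assoc k A C C).toLinearMap LinearMap.id
    ∘ₗ (TensorProduct.assoc k (A ⊗[k] C) C A).symm.toLinearMap
    ∘ₗ lTensor (A ⊗[k] C) ψ

/-- The right-hand side of the associativity condition (Oeq):
`(m_C ⊗ id_A) ∘ (id_C ⊗ ψ) ∘ (id_C ⊗ m_A ⊗ id_C) ∘ (ψ ⊗ id_A ⊗ id_C)`. -/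
def OeqRHS (ψ : A ⊗[k] C →ₗ[k] C ⊗[k] A) :
    (A ⊗[k] C) ⊗[k] (A ⊗[k] C) →ₗ[k] C ⊗[k] A :=
  rTensor A (LinearMap.mul' k C)
    ∘ₗ (TensorProduct.assoc k C C A).symm.toLinearMap
    ∘ₗ lTensor C ψ
    ∘ₗ (TensorProduct.assoc k C A C).toLinearMap
    ∘ₗ TensorProduct.map (lTensor C (LinearMap.mul' k A)) LinearMap.id
    ∘ₗ TensorProduct.map (TensorProduct.assoc k C A A).toLinearMap LinearMap.id
    ∘ₗ (TensorProduct.assoc k (C ⊗[k] A) A C).symm.toLinearMap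
    ∘ₗ rTensor (A ⊗[k] C) ψ

/-- The set of relations `c ⊗ (b·a) - (c·F(b)) ⊗ a` defining the push-forward `C ⊗_B A`. -/
def relSet (B : Subalgebra k A) (F : B →ₐ[k] C) : Set (C ⊗[k] A) :=
  {x | ∃ (c : C) (b : B) (a : A), x = c ⊗ₜ ((b : A) * a) - (c * F b) ⊗ₜ a}

/-- The subspace spanned by the relations defining the push-forward `C ⊗_B A`. -/
def relSpan (B : Subalgebra k A) (F : B →ₐ[k] C) : Submodule k (C ⊗[k] A) :=
  Submodule.span k (relSet k A C B F)

end Twist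
section Star
variable [StarRing k] [TrivialStar k]
variable (X : Type*) [Ring X] [Algebra k X] [StarRing X] [StarModule k X]
variable (Y : Type*) [Ring Y] [Algebra k Y] [StarRing Y] [StarModule k Y]

/-- The map `(∗_Y ⊗ ∗_X) ∘ flip : X ⊗ Y → Y ⊗ X`, `x ⊗ y ↦ y* ⊗ x*`. -/
def starFlip : X ⊗[k] Y →ₗ[k] Y ⊗[k] X :=
  TensorProduct.lift (LinearMap.mk₂ k (fun x y => (star y : Y) ⊗ₜ[k] (star x : X))
    (fun x x' y => by simp [star_add, TensorProduct.tmul_add])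
    (fun r x y => by simp [star_smul, star_trivial, TensorProduct.tmul_smul])
    (fun x y y' => by simp [star_add, TensorProduct.add_tmul])
    (fun r x y => by simp [star_smul, star_trivial, TensorProduct.smul_tmul']))

@[simp] lemma starFlip_tmul (x : X) (y : Y) :
    starFlip k X Y (x ⊗ₜ y) = (star y : Y) ⊗ₜ (star x : X) := rfl

end Star
section Flat
variable (R : Type*) [Ring R] (M : Type*) [AddCommGroup M] [Module R M]

/-- Flatness of a left module over a (possibly noncommutative) ring, via the equational
criterion: every linear relation among elements of `M` is a consequence of linear relations
holding in `R`. -/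
def IsFlatLeft : Prop :=
  ∀ (n : ℕ) (r : Fin n → R) (x : Fin n → M), (∑ i, r i • x i) = 0 →
    ∃ (m : ℕ) (a : Fin n → Fin m → R) (y : Fin m → M),
      (∀ i, x i = ∑ j, a i j • y j) ∧ ∀ j, (∑ i, r i * a i j) = 0

/-- Faithful flatness of a left module over a (possibly noncommutative) ring: flatness
together with `I·M ≠ M` for every maximal right ideal `I` of `R`. -/
def IsFaithfullyFlatLeft : Prop :=
  IsFlatLeft R M ∧ ∀ I : Submodule Rᵐᵒᵖ R, IsCoatom I →
    AddSubgroup.closure {z : M | ∃ i ∈ I, ∃ v : M, z = i • v} ≠ ⊤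

end Flat
section Hopf
variable (A : Type*) [Ring A] [Algebra k A] (C : Type*) [Ring C] [Algebra k C]
variable (H : Type*) [Ring H] [HopfAlgebra k H]

/-- `δ : A → A ⊗ H` makes `A` a right `H`-comodule algebra: `δ` is an algebra map (built in)
which is coassociative and counital. -/
def IsComodAlg (δ : A →ₐ[k] A ⊗[k] H) : Prop :=
  ((TensorProduct.assoc k A H H).toLinearMap ∘ₗ rTensor H δ.toLinearMap ∘ₗ δ.toLinearMap
      = lTensor A (Coalgebra.comul (R := k) (A := H)) ∘ₗ δ.toLinearMap)
    ∧ ((TensorProduct.rid k A).toLinearMap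
        ∘ₗ lTensor A (Coalgebra.counit (R := k) (A := H)) ∘ₗ δ.toLinearMap
      = LinearMap.id)

/-- The subalgebra `A^{co H}` of coinvariant elements of a comodule algebra. -/
def coinv (δ : A →ₐ[k] A ⊗[k] H) : Subalgebra k A where
  carrier := {a | δ a = a ⊗ₜ[k] (1 : H)}
  mul_mem' := by
    intro a b ha hb
    simp only [Set.mem_setOf_eq] at *
    rw [map_mul, ha, hb, Algebra.TensorProduct.tmul_mul_tmul, one_mul]
  one_mem' := by
    simp only [Set.mem_setOf_eq, map_one, Algebra.TensorProduct.one_def]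
  add_mem' := by
    intro a b ha hb
    simp only [Set.mem_setOf_eq] at *
    rw [map_add, ha, hb, TensorProduct.add_tmul]
  algebraMap_mem' := by
    intro r
    simp only [Set.mem_setOf_eq, AlgHom.commutes, Algebra.TensorProduct.algebraMap_apply]

/-- The canonical map `A ⊗ A → A ⊗ H`, `a ⊗ a' ↦ a a'₍₀₎ ⊗ a'₍₁₎` (before taking the
quotient `A ⊗_B A`). -/
def chi0 (δ : A →ₐ[k] A ⊗[k] H) : A ⊗[k] A →ₗ[k] A ⊗[k] H :=
  rTensor H (LinearMap.mul' k A)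
    ∘ₗ (TensorProduct.assoc k A A H).symm.toLinearMap
    ∘ₗ lTensor A δ.toLinearMap

/-- The coaction `id_C ⊗ δ` on `C ⊗ A` (with `C` a trivial comodule), as a map
`C ⊗ A → (C ⊗ A) ⊗ H`. -/
def coactT (δ : A →ₐ[k] A ⊗[k] H) : C ⊗[k] A →ₗ[k] (C ⊗[k] A) ⊗[k] H :=
  (TensorProduct.assoc k C A H).symm.toLinearMap ∘ₗ lTensor C δ.toLinearMap

/-- `ψ : A ⊗ C → C ⊗ A` is a morphism of right `H`-comodules:
`(id_C ⊗ δ) ∘ ψ = (ψ ⊗ id_H) ∘ (id_A ⊗ flip) ∘ (δ ⊗ id_C)`. -/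
def IsComodMor (δ : A →ₐ[k] A ⊗[k] H) (ψ : A ⊗[k] C →ₗ[k] C ⊗[k] A) : Prop :=
  lTensor C δ.toLinearMap ∘ₗ ψ
    = (TensorProduct.assoc k C A H).toLinearMap
        ∘ₗ rTensor H ψ
        ∘ₗ (TensorProduct.assoc k A C H).symm.toLinearMap
        ∘ₗ lTensor A (TensorProduct.comm k H C).toLinearMap
        ∘ₗ (TensorProduct.assoc k A H C).toLinearMap
        ∘ₗ rTensor C δ.toLinearMap

variable {k H} in
/-- Given a multiplication `m` on `P`, the induced multiplication on `P ⊗ H`. -/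
def tmulH {P : Type*} [AddCommGroup P] [Module k P] (m : P →ₗ[k] P →ₗ[k] P) :
    P ⊗[k] H →ₗ[k] P ⊗[k] H →ₗ[k] P ⊗[k] H :=
  TensorProduct.map₂ m (LinearMap.mul k H)

variable {k H} in
/-- The canonical Galois map `P ⊗ P → P ⊗ H`, `x ⊗ y ↦ (x ·_m y₍₀₎) ⊗ y₍₁₎`, for a
multiplication `m` and a coaction `db` on `P`. -/
def chiP {P : Type*} [AddCommGroup P] [Module k P]
    (m : P →ₗ[k] P →ₗ[k] P) (db : P →ₗ[k] P ⊗[k] H) : P ⊗[k] P →ₗ[k] P ⊗[k] H :=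
  rTensor H (TensorProduct.lift m)
    ∘ₗ (TensorProduct.assoc k P P H).symm.toLinearMap
    ∘ₗ lTensor P db

variable {k C} in
/-- The span of the relations `(x ·_m e c) ⊗ y - x ⊗ (e c ·_m y)` defining the balanced tensor
product `P ⊗_C P` over the image of `C` in `P`. -/
def balSpan {P : Type*} [AddCommGroup P] [Module k P]
    (m : P →ₗ[k] P →ₗ[k] P) (e : C → P) : Submodule k (P ⊗[k] P) :=
  Submodule.span k {z | ∃ (x y : P) (c : C), z = (m x (e c)) ⊗ₜ y - x ⊗ₜ (m (e c) y)}

variable {k H} in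
/-- Coassociativity of a coaction `db : P → P ⊗ H`. -/
def Coassoc {P : Type*} [AddCommGroup P] [Module k P] (db : P →ₗ[k] P ⊗[k] H) : Prop :=
  (TensorProduct.assoc k P H H).toLinearMap ∘ₗ rTensor H db ∘ₗ db
    = lTensor P (Coalgebra.comul (R := k) (A := H)) ∘ₗ db

variable {k H} in
/-- Counitality of a coaction `db : P → P ⊗ H`. -/
def Counital {P : Type*} [AddCommGroup P] [Module k P] (db : P →ₗ[k] P ⊗[k] H) : Prop :=
  (TensorProduct.rid k P).toLinearMap
      ∘ₗ lTensor P (Coalgebra.counit (R := k) (A := H)) ∘ₗ db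
    = LinearMap.id

variable {k H} in
/-- Convolution product of two linear maps `H → P`, with respect to a multiplication `m`
on `P`. -/
def convP {P : Type*} [AddCommGroup P] [Module k P]
    (m : P →ₗ[k] P →ₗ[k] P) (f g : H →ₗ[k] P) : H →ₗ[k] P :=
  TensorProduct.lift m ∘ₗ TensorProduct.map f g ∘ₗ Coalgebra.comul (R := k) (A := H)

variable {k H} in
/-- The unit for convolution: `h ↦ ε(h) • u`. -/
def convUnit {P : Type*} [AddCommGroup P] [Module k P] (u : P) : H →ₗ[k] P :=
  (Coalgebra.counit (R := k) (A := H)).smulRight u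

end Hopf

section HopfPush
variable (A : Type*) [Ring A] [Algebra k A] (C : Type*) [Ring C] [Algebra k C]
variable (H : Type*) [Ring H] [HopfAlgebra k H]
section PushForward
variable (δ : A →ₐ[k] A ⊗[k] H) (F : coinv k A H δ →ₐ[k] C)

/-- The subspace of `C ⊗ A` defining the push-forward `C ⊗_B A`, `B = A^{co H}`. -/
def pushSpan : Submodule k (C ⊗[k] A) := relSpan k A C (coinv k A H δ) F

/-- The quotient map `C ⊗ A → C ⊗_B A`. -/
def pushQ : C ⊗[k] A →ₗ[k] (C ⊗[k] A) ⧸ pushSpan k A C H δ F :=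
  (pushSpan k A C H δ F).mkQ

/-- `\barψ = π_B ∘ ψ` is a `B`-bimodule morphism. -/
def BarBimod (ψ : A ⊗[k] C →ₗ[k] C ⊗[k] A) : Prop :=
  (∀ (b : coinv k A H δ) (a : A) (c : C),
      pushQ k A C H δ F (ψ (((b : A) * a) ⊗ₜ c))
        = pushQ k A C H δ F (rTensor A (LinearMap.mulLeft k (F b)) (ψ (a ⊗ₜ c))))
  ∧ (∀ (b : coinv k A H δ) (a : A) (c : C),
      pushQ k A C H δ F (ψ (a ⊗ₜ (c * F b)))
        = pushQ k A C H δ F (lTensor C (LinearMap.mulRight k (b : A)) (ψ (a ⊗ₜ c))))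

/-- `\barψ (1_A ⊗ c) = c ⊗_B 1_A` and `\barψ (a ⊗ 1_C) = 1_C ⊗_B a`. -/
def BarNormal (ψ : A ⊗[k] C →ₗ[k] C ⊗[k] A) : Prop :=
  (∀ c : C, pushQ k A C H δ F (ψ ((1 : A) ⊗ₜ c)) = pushQ k A C H δ F (c ⊗ₜ (1 : A)))
  ∧ (∀ a : A, pushQ k A C H δ F (ψ (a ⊗ₜ (1 : C))) = pushQ k A C H δ F ((1 : C) ⊗ₜ a))

/-- `σ` is the canonical left `C`-action on the push-forward `C ⊗_B A`:
`σ c (c' ⊗_B a) = (c c') ⊗_B a`. -/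
def SigmaSpec (σ : C →ₗ[k] ((C ⊗[k] A) ⧸ pushSpan k A C H δ F)
    →ₗ[k] ((C ⊗[k] A) ⧸ pushSpan k A C H δ F)) : Prop :=
  ∀ (c : C) (x : C ⊗[k] A),
    σ c (pushQ k A C H δ F x) = pushQ k A C H δ F (rTensor A (LinearMap.mulLeft k c) x)

/-- The distributive law `\barψ (a ⊗ c c') = c^ψ · \barψ (a^ψ ⊗ c')`, where `·` denotes the
left `C`-action `σ` on the push-forward. -/
def BarDistrib (ψ : A ⊗[k] C →ₗ[k] C ⊗[k] A)
    (σ : C →ₗ[k] ((C ⊗[k] A) ⧸ pushSpan k A C H δ F)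
      →ₗ[k] ((C ⊗[k] A) ⧸ pushSpan k A C H δ F)) : Prop :=
  (pushQ k A C H δ F ∘ₗ ψ) ∘ₗ lTensor A (LinearMap.mul' k C)
    = TensorProduct.lift σ
        ∘ₗ lTensor C (pushQ k A C H δ F ∘ₗ ψ)
        ∘ₗ (TensorProduct.assoc k C A C).toLinearMap
        ∘ₗ rTensor C ψ
        ∘ₗ (TensorProduct.assoc k A C C).symm.toLinearMap

/-- The embedding `C → C ⊗_B A`, `c ↦ c ⊗_B 1_A`. -/
def eC : C → (C ⊗[k] A) ⧸ pushSpan k A C H δ F :=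
  fun c => pushQ k A C H δ F (c ⊗ₜ (1 : A))

end PushForward

section Galois
variable (δ : A →ₐ[k] A ⊗[k] H)

/-- The subspace of `A ⊗ A` defining the balanced tensor product `A ⊗_B A`, `B = A^{co H}`. -/
def galSpan : Submodule k (A ⊗[k] A) :=
  relSpan k A A (coinv k A H δ) (coinv k A H δ).val

/-- The quotient map `A ⊗ A → A ⊗_B A`. -/
def galQ : A ⊗[k] A →ₗ[k] (A ⊗[k] A) ⧸ galSpan k A H δ := (galSpan k A H δ).mkQ

/-- The translation map `τ = χ⁻¹(1_A ⊗ -) : H → A ⊗_B A` obtained from a bijective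
canonical map `χ`. -/
def transMap (χ : ((A ⊗[k] A) ⧸ galSpan k A H δ) ≃ₗ[k] A ⊗[k] H) :
    H →ₗ[k] (A ⊗[k] A) ⧸ galSpan k A H δ :=
  χ.symm.toLinearMap ∘ₗ TensorProduct.mk k A H 1

end Galois
end HopfPush
end Paper

namespace PaperAux
set_option linter.unusedSectionVars false
open Paper

lemma exists_desc {k X P M : Type*} [Field k] [AddCommGroup X] [Module k X] [AddCommGroup P]
    [Module k P] [AddCommGroup M] [Module k M] (π : X →ₗ[k] P) (hπ : Function.Surjective π)
    (S : Set X) (hker : LinearMap.ker π = Submodule.span k S) (f : X →ₗ[k] M)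
    (hf : ∀ x ∈ S, f x = 0) : ∃ g : P →ₗ[k] M, ∀ x, g (π x) = f x := by
  have hle : LinearMap.ker π ≤ LinearMap.ker f := by
    rw [hker, Submodule.span_le]
    intro x hx
    exact hf x hx
  refine ⟨(LinearMap.ker π).liftQ f hle ∘ₗ (π.quotKerEquivOfSurjective hπ).symm.toLinearMap, ?_⟩
  intro x
  have : (π.quotKerEquivOfSurjective hπ).symm (π x) = (LinearMap.ker π).mkQ x := by
    rw [LinearEquiv.symm_apply_eq]; rfl
  simp [this]

lemma exists_fin_ker {k N X Y : Type*} [Field k] [AddCommGroup N] [Module k N]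
    [AddCommGroup X] [Module k X] [AddCommGroup Y] [Module k Y] (f : X →ₗ[k] Y)
    (z : N ⊗[k] X) (hz : lTensor N f z = 0) :
    ∃ T : Finset (N × LinearMap.ker f), z = ∑ x ∈ T, x.1 ⊗ₜ[k] (x.2 : X) := by
  have hex : Function.Exact (lTensor N (LinearMap.ker f).subtype) (lTensor N f) :=
    Module.Flat.lTensor_exact N (LinearMap.exact_subtype_ker_map f)
  obtain ⟨v, rfl⟩ := (hex z).1 hz
  obtain ⟨T, hT⟩ := TensorProduct.exists_finset v
  exact ⟨T, by rw [hT, map_sum]; simp⟩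

section Gen
variable {k R A N : Type*} [Field k] [Ring R] [Algebra k R] [AddCommGroup A] [Module k A]
  [Module R A] [IsScalarTower k R A] [AddCommGroup N] [Module k N]

lemma flat_sys (hfl : IsFlatLeft R A) (S : Finset A) : ∀ L : List (A →₀ R),
    (∀ s ∈ L, s.support ⊆ S ∧ Finsupp.linearCombination R (id : A → A) s = 0) →
    ∃ (q : ℕ) (t : Fin q → A → R) (y : Fin q → A), (∀ a ∈ S, a = ∑ j, t j a • y j) ∧
      ∀ s ∈ L, ∀ j, Finsupp.linearCombination R (t j) s = 0 := by
  classical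
  intro L
  induction L with
  | nil =>
    intro _
    refine ⟨S.card, fun j a => if (S.equivFin.symm j : A) = a then 1 else 0,
      fun j => S.equivFin.symm j, ?_, by simp⟩
    intro a ha
    rw [Finset.sum_eq_single (S.equivFin ⟨a, ha⟩)]
    · simp
    · intro j _ hj
      beta_reduce
      rw [if_neg, zero_smul]
      intro h
      apply hj
      rw [← Equiv.symm_apply_eq]
      exact Subtype.ext h
    · simp
  | cons s L ih =>
    intro h
    obtain ⟨q, t, y, h1, h2⟩ := ih (fun s' hs' => h s' (List.mem_cons_of_mem _ hs'))
    obtain ⟨hs1, hs2⟩ := h s List.mem_cons_self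
    have hz : ∑ j, Finsupp.linearCombination R (t j) s • y j = 0 := by
      rw [← hs2]
      simp only [Finsupp.linearCombination_apply, Finsupp.sum, Finset.sum_smul, _root_.id]
      rw [Finset.sum_comm]
      apply Finset.sum_congr rfl
      intro a ha
      have e : s a • a = s a • ∑ j, t j a • y j := congrArg (s a • ·) (h1 a (hs1 ha))
      rw [e]
      simp [Finset.smul_sum, mul_smul]
    obtain ⟨q', t', y', h3, h4⟩ := hfl q _ y hz
    refine ⟨q', fun j a => ∑ i, t i a * t' i j, y', ?_, ?_⟩
    · intro a ha
      conv_lhs => rw [h1 a ha]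
      simp only [Finset.sum_smul]
      rw [Finset.sum_comm]
      apply Finset.sum_congr rfl
      intro i _
      rw [h3 i, Finset.smul_sum]
      simp [mul_smul]
    · have key : ∀ (s' : A →₀ R) j, Finsupp.linearCombination R
          (fun a => ∑ i, t i a * t' i j) s' =
          ∑ i, Finsupp.linearCombination R (t i) s' * t' i j := by
        intro s' j
        simp only [Finsupp.linearCombination_apply, Finsupp.sum, Finset.sum_mul, smul_eq_mul,
          Finset.mul_sum]
        rw [Finset.sum_comm]
        simp [mul_assoc]
      intro s' hs' j
      rw [key]
      rcases List.mem_cons.1 hs' with rfl | hs'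
      · exact h4 j
      · simp [h2 s' hs']

/-- relations for the balanced tensor product -/
def tSpan (A : Type*) [AddCommGroup A] [Module k A] [Module R A]
    (ρ : N →ₗ[k] R →ₗ[k] N) : Submodule k (N ⊗[k] A) :=
  Submodule.span k {z | ∃ n r a, z = n ⊗ₜ[k] (r • a : A) - (ρ n r) ⊗ₜ[k] a}

def phi (ρ : N →ₗ[k] R →ₗ[k] N) (t : A → R) : N ⊗[k] (A →₀ R) →ₗ[k] N :=
  TensorProduct.lift (ρ.compl₂ ((Finsupp.linearCombination R t).restrictScalars k))

@[simp] lemma phi_tmul (ρ : N →ₗ[k] R →ₗ[k] N) (t : A → R) (n : N) (s : A →₀ R) :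
    phi ρ t (n ⊗ₜ s) = ρ n (Finsupp.linearCombination R t s) := rfl

set_option maxHeartbeats 1000000 in
lemma vanish (hfl : IsFlatLeft R A) (ρ : N →ₗ[k] R →ₗ[k] N)
    (hρ : ∀ n r s, ρ (ρ n r) s = ρ n (r * s)) (hρ1 : ∀ n, ρ n 1 = n)
    {ι : Type*} [Fintype ι] (n : ι → N) (a : ι → A)
    (h : ∑ i, n i ⊗ₜ[k] a i ∈ tSpan A ρ) :
    ∃ (q : ℕ) (r : ι → Fin q → R) (y : Fin q → A), (∀ i, a i = ∑ j, r i j • y j) ∧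
      ∀ j, ∑ i, ρ (n i) (r i j) = 0 := by
  classical
  let ev0 : (A →₀ R) →ₗ[k] A := (Finsupp.linearCombination R (id : A → A)).restrictScalars k
  have hev0 : ∀ s, ev0 s = Finsupp.linearCombination R (id : A → A) s := fun s => rfl
  let ev : N ⊗[k] (A →₀ R) →ₗ[k] N ⊗[k] A := lTensor N ev0
  have hle : tSpan A ρ ≤ (⨅ t : A → R, LinearMap.ker (phi ρ t)).map ev := by
    rw [tSpan, Submodule.span_le]
    rintro _ ⟨n, r, a, rfl⟩
    refine ⟨n ⊗ₜ Finsupp.single a r - ρ n r ⊗ₜ Finsupp.single a 1, ?_, ?_⟩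
    · simp [hρ]
    · simp [ev, hev0]
  obtain ⟨w, hw, hwz⟩ := hle h
  have hw' : ∀ t : A → R, phi ρ t w = 0 := by
    intro t
    simpa using (Submodule.mem_iInf _).1 hw t
  let w0 : N ⊗[k] (A →₀ R) := ∑ i, n i ⊗ₜ Finsupp.single (a i) 1
  have hw0 : ev w0 = ∑ i, n i ⊗ₜ[k] a i := by
    simp [w0, ev, hev0]
  have hd : ev (w - w0) = 0 := by rw [map_sub, hwz, hw0, sub_self]
  obtain ⟨T, hT⟩ := exists_fin_ker ev0 (w - w0) hd
  let L : List (A →₀ R) := T.toList.map (fun x => (x.2 : A →₀ R))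
  let S : Finset A := Finset.univ.image a ∪ T.biUnion (fun x => (x.2 : A →₀ R).support)
  obtain ⟨q, t, y, h1, h2⟩ := flat_sys hfl S L (by
    intro s hs
    simp only [L, List.mem_map, Finset.mem_toList] at hs
    obtain ⟨x, hx, rfl⟩ := hs
    refine ⟨?_, ?_⟩
    · intro b hb
      exact Finset.mem_union_right _ (Finset.mem_biUnion.2 ⟨x, hx, hb⟩)
    · exact x.2.2)
  refine ⟨q, fun i j => t j (a i), y, ?_, ?_⟩
  · intro i
    exact h1 (a i) (Finset.mem_union_left _ (Finset.mem_image_of_mem _ (Finset.mem_univ i)))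
  · intro j
    have e1 : phi ρ (t j) (w - w0) = 0 := by
      rw [hT, map_sum]
      apply Finset.sum_eq_zero
      intro x hx
      rw [phi_tmul, h2 _ (List.mem_map.2 ⟨x, Finset.mem_toList.2 hx, rfl⟩), map_zero]
    rw [map_sub, hw', zero_sub, neg_eq_zero] at e1
    simpa [w0] using e1

lemma ff_zero (hff : IsFaithfullyFlatLeft R A) (ρ : N →ₗ[k] R →ₗ[k] N)
    (hρ : ∀ n r s, ρ (ρ n r) s = ρ n (r * s)) (hρ1 : ∀ n, ρ n 1 = n)
    (n : N) (h : ∀ a : A, n ⊗ₜ[k] a ∈ tSpan A ρ) : n = 0 := by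
  by_contra hn
  let J : Submodule Rᵐᵒᵖ R :=
    { carrier := {r | ρ n r = 0}
      add_mem' := by
        intro a b ha hb
        simp only [Set.mem_ofPred_eq] at *
        simp [ha, hb]
      zero_mem' := by simp
      smul_mem' := by
        intro c x hx
        simp only [Set.mem_ofPred_eq] at *
        change ρ n (x * c.unop) = 0
        rw [← hρ, hx]; simp }
  have hfin : Module.Finite Rᵐᵒᵖ R := ⟨⟨{1}, by
    rw [eq_top_iff]
    intro x _
    rw [Finset.coe_singleton, Submodule.mem_span_singleton]
    exact ⟨MulOpposite.op x, by simp⟩⟩⟩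
  have hJ : J ≠ ⊤ := by
    intro hJ
    have : (1 : R) ∈ J := hJ ▸ Submodule.mem_top
    have h1 : ρ n 1 = 0 := this
    rw [hρ1] at h1
    exact hn h1
  obtain ⟨I, hI, hJI⟩ := (eq_top_or_exists_le_coatom J).resolve_left hJ
  apply hff.2 I hI
  rw [eq_top_iff]
  intro a _
  obtain ⟨q, r, y, h1, h2⟩ := vanish hff.1 ρ hρ hρ1 (fun _ : Unit => n) (fun _ => a)
    (by simpa using h a)
  rw [h1 ()]
  apply AddSubgroup.sum_mem
  intro j _
  apply AddSubgroup.subset_closure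
  refine ⟨r () j, hJI ?_, y j, rfl⟩
  have h3 := h2 j
  rw [Fintype.sum_unique] at h3
  exact h3

end Gen
end PaperAux
namespace PaperAux
open Paper
section Core
variable {k A C H P : Type*} [Field k] [Ring A] [Algebra k A] [Ring C] [Algebra k C]
  [AddCommGroup P] [Module k P]

lemma P_ext {M : Type*} [AddCommGroup M] [Module k M] {π : C ⊗[k] A →ₗ[k] P}
    (hπ : Function.Surjective π) {f g : P →ₗ[k] M}
    (h : ∀ c a, f (π (c ⊗ₜ a)) = g (π (c ⊗ₜ a))) : f = g := by
  have : f ∘ₗ π = g ∘ₗ π := TensorProduct.ext' h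
  ext x
  obtain ⟨z, rfl⟩ := hπ x
  exact LinearMap.congr_fun this z

lemma exists_rm (B : Subalgebra k A) (F : B →ₐ[k] C) (π : C ⊗[k] A →ₗ[k] P)
    (hπ : Function.Surjective π) (hker : LinearMap.ker π = relSpan k A C B F)
    (hrel : ∀ c (b : B) a, π (c ⊗ₜ ((b : A) * a)) = π ((c * F b) ⊗ₜ a)) :
    ∃ rm : P →ₗ[k] A →ₗ[k] P, ∀ x a, rm (π x) a = π (lTensor C (LinearMap.mulRight k a) x) := by
  obtain ⟨g, hg⟩ := exists_desc π hπ _ hker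
    (((LinearMap.lTensorHom C ∘ₗ (LinearMap.mul k A).flip).flip).compr₂ π) (by
      rintro _ ⟨c, b, a, rfl⟩
      ext a'
      simp only [map_sub, LinearMap.sub_apply, LinearMap.zero_apply, LinearMap.compr₂_apply,
        LinearMap.flip_apply, LinearMap.comp_apply, LinearMap.coe_lTensorHom, lTensor_tmul,
        LinearMap.mul_apply', mul_assoc]
      rw [hrel, sub_self])
  refine ⟨g, ?_⟩
  intro x a
  rw [hg]
  simp only [LinearMap.compr₂_apply,
        LinearMap.flip_apply, LinearMap.comp_apply, LinearMap.coe_lTensorHom]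
  rfl

lemma exists_lm (B : Subalgebra k A) (F : B →ₐ[k] C) (π : C ⊗[k] A →ₗ[k] P)
    (hπ : Function.Surjective π) (hker : LinearMap.ker π = relSpan k A C B F)
    (hrel : ∀ c (b : B) a, π (c ⊗ₜ ((b : A) * a)) = π ((c * F b) ⊗ₜ a)) (c : C) :
    ∃ lm : P →ₗ[k] P, ∀ x, lm (π x) = π (rTensor A (LinearMap.mulLeft k c) x) := by
  obtain ⟨g, hg⟩ := exists_desc π hπ _ hker (π ∘ₗ rTensor A (LinearMap.mulLeft k c)) (by
      rintro _ ⟨c, b, a, rfl⟩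
      simp only [map_sub, LinearMap.comp_apply, rTensor_tmul, LinearMap.mulLeft_apply]
      rw [hrel, sub_eq_zero, mul_assoc])
  exact ⟨g, hg⟩

lemma tmul_eq (ψ : A ⊗[k] C →ₗ[k] C ⊗[k] A) (c c' : C) (a a' : A) :
    tmul k A C ψ (c ⊗ₜ a) (c' ⊗ₜ a') =
      lTensor C (LinearMap.mulRight k a') (rTensor A (LinearMap.mulLeft k c) (ψ (a ⊗ₜ c'))) := by
  simp only [Paper.tmul, tmulMap, LinearMap.comp_apply, LinearEquiv.coe_coe,
    TensorProduct.assoc_symm_tmul, TensorProduct.map_tmul, TensorProduct.assoc_tmul, lTensor_tmul,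
    LinearMap.id_apply]
  generalize ψ (a ⊗ₜ c') = w
  induction w with
  | zero => simp
  | add x y hx hy => simp only [TensorProduct.tmul_add, TensorProduct.add_tmul, map_add, hx, hy]
  | tmul x y => simp

variable [Ring H] [HopfAlgebra k H]

lemma chi0_tmul (δ : A →ₐ[k] A ⊗[k] H) (a a' : A) :
    chi0 k A H δ (a ⊗ₜ a') = rTensor H (LinearMap.mulLeft k a) (δ a') := by
  simp only [chi0, LinearMap.comp_apply, LinearEquiv.coe_coe, lTensor_tmul,
    AlgHom.toLinearMap_apply]
  generalize δ a' = w
  induction w with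
  | zero => simp
  | add x y hx hy => simp only [TensorProduct.tmul_add, map_add, hx, hy]
  | tmul x y => simp

lemma coactT_tmul (δ : A →ₐ[k] A ⊗[k] H) (c : C) (a : A) :
    coactT k A C H δ (c ⊗ₜ a) = rTensor H (TensorProduct.mk k C A c) (δ a) := by
  simp only [coactT, LinearMap.comp_apply, LinearEquiv.coe_coe, lTensor_tmul,
    AlgHom.toLinearMap_apply]
  generalize δ a = w
  induction w with
  | zero => simp
  | add x y hx hy => simp only [TensorProduct.tmul_add, map_add, hx, hy]
  | tmul x y => simp

lemma chiP_tmul (m : P →ₗ[k] P →ₗ[k] P) (db : P →ₗ[k] P ⊗[k] H) (x y : P) :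
    chiP m db (x ⊗ₜ y) = rTensor H (m x) (db y) := by
  simp only [chiP, LinearMap.comp_apply, LinearEquiv.coe_coe, lTensor_tmul]
  generalize db y = w
  induction w with
  | zero => simp
  | add x y hx hy => simp only [TensorProduct.tmul_add, map_add, hx, hy]
  | tmul x y => simp

/-- right multiplication on `(C ⊗ A) ⊗ H` -/
def Mr (k A C H : Type*) [Field k] [Ring A] [Algebra k A] [Ring C] [Algebra k C]
    [Ring H] [HopfAlgebra k H] :
    (A ⊗[k] H) →ₗ[k] ((C ⊗[k] A) ⊗[k] H) →ₗ[k] ((C ⊗[k] A) ⊗[k] H) :=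
  TensorProduct.map₂ (LinearMap.lTensorHom C ∘ₗ (LinearMap.mul k A).flip) (LinearMap.mul k H).flip

lemma Mr_tmul (a : A) (h h' : H) (x : C ⊗[k] A) :
    Mr k A C H (a ⊗ₜ h) (x ⊗ₜ h') = lTensor C (LinearMap.mulRight k a) x ⊗ₜ (h' * h) := rfl

lemma coact_right (δ : A →ₐ[k] A ⊗[k] H) (a' : A) (y : C ⊗[k] A) :
    coactT k A C H δ (lTensor C (LinearMap.mulRight k a') y) =
      Mr k A C H (δ a') (coactT k A C H δ y) := by
  induction y with
  | zero => simp
  | add x y hx hy => simp only [map_add, hx, hy]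
  | tmul c a =>
    rw [lTensor_tmul, coactT_tmul, coactT_tmul, LinearMap.mulRight_apply, map_mul]
    generalize δ a = u
    generalize δ a' = v
    induction v with
    | zero => simp
    | add x y hx hy => simp only [map_add, mul_add, LinearMap.add_apply, hx, hy]
    | tmul x y =>
      induction u with
      | zero => simp
      | add x y hx hy => simp only [map_add, add_mul, hx, hy]
      | tmul x' y' => simp [Mr_tmul]

lemma coact_left (δ : A →ₐ[k] A ⊗[k] H) (c : C) (y : C ⊗[k] A) :
    coactT k A C H δ (rTensor A (LinearMap.mulLeft k c) y) =
      rTensor H (rTensor A (LinearMap.mulLeft k c)) (coactT k A C H δ y) := by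
  induction y with
  | zero => simp
  | add x y hx hy => simp only [map_add, hx, hy]
  | tmul c' a =>
    rw [rTensor_tmul, coactT_tmul, coactT_tmul, ← LinearMap.rTensor_comp_apply]
    rfl

lemma coact_psi (δ : A →ₐ[k] A ⊗[k] H) (ψ : A ⊗[k] C →ₗ[k] C ⊗[k] A)
    (hcomod : IsComodMor k A C H δ ψ) (a : A) (c : C) :
    coactT k A C H δ (ψ (a ⊗ₜ c)) =
      rTensor H (ψ ∘ₗ (TensorProduct.mk k A C).flip c) (δ a) := by
  have h := LinearMap.congr_fun hcomod (a ⊗ₜ c)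
  simp only [LinearMap.comp_apply, LinearEquiv.coe_coe] at h
  simp only [coactT, LinearMap.comp_apply, LinearEquiv.coe_coe]
  rw [h, LinearEquiv.symm_apply_apply, rTensor_tmul, AlgHom.toLinearMap_apply]
  generalize δ a = w
  induction w with
  | zero => simp
  | add x y hx hy => simp only [TensorProduct.add_tmul, map_add, hx, hy]
  | tmul x y => simp

/-- the embedding `a ↦ π (c ⊗ a)` -/
def jm (π : C ⊗[k] A →ₗ[k] P) (c : C) : A →ₗ[k] P := π ∘ₗ TensorProduct.mk k C A c

lemma jm_apply (π : C ⊗[k] A →ₗ[k] P) (c : C) (a : A) : jm π c a = π (c ⊗ₜ a) := rfl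

lemma db_eq (δ : A →ₐ[k] A ⊗[k] H) (π : C ⊗[k] A →ₗ[k] P) (db : P →ₗ[k] P ⊗[k] H)
    (hdb : ∀ x : C ⊗[k] A, db (π x) = rTensor H π (coactT k A C H δ x)) (c : C) (a : A) :
    db (π (c ⊗ₜ a)) = rTensor H (jm π c) (δ a) := by
  rw [hdb, coactT_tmul, ← LinearMap.rTensor_comp_apply]; rfl

lemma db_mul (δ : A →ₐ[k] A ⊗[k] H) (ψ : A ⊗[k] C →ₗ[k] C ⊗[k] A)
    (hcomod : IsComodMor k A C H δ ψ) (π : C ⊗[k] A →ₗ[k] P) (hπ : Function.Surjective π)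
    (m : P →ₗ[k] P →ₗ[k] P) (hm : ∀ x y, m (π x) (π y) = π (tmul k A C ψ x y))
    (db : P →ₗ[k] P ⊗[k] H)
    (hdb : ∀ x : C ⊗[k] A, db (π x) = rTensor H π (coactT k A C H δ x)) (p q : P) :
    db (m p q) = tmulH m (db p) (db q) := by
  have h : m.compr₂ db = (tmulH m).compl₁₂ db db := by
    apply P_ext hπ
    intro c a
    apply P_ext hπ
    intro c' a'
    simp only [LinearMap.compr₂_apply, LinearMap.compl₁₂_apply]
    rw [db_eq δ π db hdb, db_eq δ π db hdb, hm, tmul_eq, hdb, coact_right, coact_left,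
      coact_psi δ ψ hcomod]
    generalize δ a = u
    generalize δ a' = v
    induction v with
    | zero => simp
    | add x y hx hy => simp only [map_add, LinearMap.add_apply, hx, hy]
    | tmul x y =>
      induction u with
      | zero => simp
      | add x y hx hy => simp only [map_add, LinearMap.add_apply, hx, hy]
      | tmul x' y' =>
        simp only [rTensor_tmul, Mr_tmul, tmulH, TensorProduct.map₂_apply_tmul, TensorProduct.map_tmul, jm_apply, hm,
          tmul_eq, LinearMap.mul_apply', LinearMap.comp_apply, LinearMap.flip_apply,
          TensorProduct.mk_apply]
  exact LinearMap.congr_fun₂ h p q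

lemma db_coassoc (δ : A →ₐ[k] A ⊗[k] H) (hδ : IsComodAlg k A H δ)
    (π : C ⊗[k] A →ₗ[k] P) (hπ : Function.Surjective π) (db : P →ₗ[k] P ⊗[k] H)
    (hdb : ∀ x : C ⊗[k] A, db (π x) = rTensor H π (coactT k A C H δ x)) : Coassoc db := by
  apply P_ext hπ
  intro c a
  have h := LinearMap.congr_fun hδ.1 a
  simp only [LinearMap.comp_apply, LinearEquiv.coe_coe, AlgHom.toLinearMap_apply] at h ⊢
  rw [db_eq δ π db hdb]
  have e1 : ∀ w : A ⊗[k] H, lTensor P (Coalgebra.comul (R := k) (A := H)) (rTensor H (jm π c) w)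
      = rTensor (H ⊗[k] H) (jm π c) (lTensor A (Coalgebra.comul (R := k) (A := H)) w) := by
    intro w
    rw [← LinearMap.comp_apply, ← LinearMap.comp_apply, LinearMap.lTensor_comp_rTensor,
      LinearMap.rTensor_comp_lTensor]
  rw [e1, ← h]
  generalize δ a = w
  induction w with
  | zero => simp
  | add x y hx hy => simp only [map_add, hx, hy]
  | tmul x y =>
    simp only [rTensor_tmul, jm_apply, db_eq δ π db hdb, AlgHom.toLinearMap_apply]
    generalize δ x = u
    induction u with
    | zero => simp
    | add x y hx hy => simp only [map_add, TensorProduct.add_tmul, hx, hy]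
    | tmul x' y' => simp [jm_apply]

lemma db_counital (δ : A →ₐ[k] A ⊗[k] H) (hδ : IsComodAlg k A H δ)
    (π : C ⊗[k] A →ₗ[k] P) (hπ : Function.Surjective π) (db : P →ₗ[k] P ⊗[k] H)
    (hdb : ∀ x : C ⊗[k] A, db (π x) = rTensor H π (coactT k A C H δ x)) : Counital db := by
  apply P_ext hπ
  intro c a
  have h := LinearMap.congr_fun hδ.2 a
  simp only [LinearMap.comp_apply, LinearEquiv.coe_coe, AlgHom.toLinearMap_apply,
    LinearMap.id_apply] at h ⊢
  rw [db_eq δ π db hdb]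
  conv_rhs => rw [← h]
  generalize δ a = w
  induction w with
  | zero => simp
  | add x y hx hy => simp only [map_add, TensorProduct.tmul_add, hx, hy]
  | tmul x y => simp [jm_apply]

/-- the inverse of the canonical map -/
lemma exists_Xi (δ : A →ₐ[k] A ⊗[k] H)
    (χ : ((A ⊗[k] A) ⧸ galSpan k A H δ) ≃ₗ[k] A ⊗[k] H)
    (hχ : ∀ x : A ⊗[k] A, χ (galQ k A H δ x) = chi0 k A H δ x)
    (F : coinv k A H δ →ₐ[k] C) (π : C ⊗[k] A →ₗ[k] P)
    (hπ : Function.Surjective π) (hker : LinearMap.ker π = relSpan k A C (coinv k A H δ) F)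
    (hrel : ∀ c (b : coinv k A H δ) a, π (c ⊗ₜ ((b : A) * a)) = π ((c * F b) ⊗ₜ a))
    {M : Type*} [AddCommGroup M] [Module k M] (g : P →ₗ[k] A →ₗ[k] M)
    (hg : ∀ c a (b : coinv k A H δ) a', g (π (c ⊗ₜ (a * b))) a' = g (π (c ⊗ₜ a)) (b * a')) :
    ∃ Ξ : P ⊗[k] H →ₗ[k] M, ∀ c (x : A ⊗[k] A),
      Ξ (rTensor H (jm π c) (chi0 k A H δ x)) = TensorProduct.lift (g ∘ₗ jm π c) x := by
  -- `f (a ⊗ a') c = g (π (c ⊗ a)) a'`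
  let f0 : C →ₗ[k] (A ⊗[k] A →ₗ[k] M) :=
    TensorProduct.lift.equiv (RingHom.id k) A A M ∘ₗ
      ((TensorProduct.mk k C A).compr₂ π).compr₂ g
  have hf0 : ∀ c, f0 c = TensorProduct.lift (g ∘ₗ jm π c) := fun c => by
    apply TensorProduct.ext'
    intro a a'
    rfl
  let f : A ⊗[k] A →ₗ[k] (C →ₗ[k] M) := f0.flip
  obtain ⟨f', hf'⟩ := exists_desc (galQ k A H δ) (Submodule.mkQ_surjective _) _
    (Submodule.ker_mkQ _) f (by
      rintro _ ⟨a, b, a', rfl⟩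
      ext c
      simp only [f, LinearMap.flip_apply, hf0, map_sub, LinearMap.sub_apply,
        TensorProduct.lift.tmul, LinearMap.comp_apply, jm_apply, LinearMap.zero_apply]
      rw [sub_eq_zero]
      exact (hg c a b a').symm)
  let s : C →ₗ[k] (A ⊗[k] H →ₗ[k] M) := (f' ∘ₗ χ.symm.toLinearMap).flip
  have hs : ∀ c x, s c (chi0 k A H δ x) = TensorProduct.lift (g ∘ₗ jm π c) x := by
    intro c x
    rw [← hf0]
    simp only [s, LinearMap.flip_apply, LinearMap.comp_apply, LinearEquiv.coe_coe, ← hχ,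
      LinearEquiv.symm_apply_apply, hf', f]
  have hsurj : ∀ w, ∃ x, chi0 k A H δ x = w := by
    intro w
    obtain ⟨x, hx⟩ := Submodule.mkQ_surjective _ (χ.symm w)
    refine ⟨x, ?_⟩
    rw [← hχ]
    exact (congrArg χ hx).trans (χ.apply_symm_apply w)
  have hsb : ∀ c (b : coinv k A H δ) w,
      s c (rTensor H (LinearMap.mulLeft k (b : A)) w) = s (c * F b) w := by
    intro c b w
    obtain ⟨x, rfl⟩ := hsurj w
    have e : rTensor H (LinearMap.mulLeft k (b : A)) (chi0 k A H δ x) =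
        chi0 k A H δ (rTensor A (LinearMap.mulLeft k (b : A)) x) := by
      induction x with
      | zero => simp
      | add x y hx hy => simp only [map_add, hx, hy]
      | tmul x y =>
        rw [rTensor_tmul, chi0_tmul, chi0_tmul, ← LinearMap.rTensor_comp_apply]
        congr 2
        ext z
        simp [mul_assoc]
    rw [e, hs, hs]
    clear e
    induction x with
    | zero => simp
    | add x y hx hy => simp only [map_add, hx, hy]
    | tmul x y =>
      simp only [rTensor_tmul, TensorProduct.lift.tmul, LinearMap.comp_apply, jm_apply,
        LinearMap.mulLeft_apply, hrel]
  obtain ⟨X, hX⟩ := exists_desc π hπ _ hker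
    (TensorProduct.lift ((TensorProduct.lift.equiv (RingHom.id k) A H M).symm.toLinearMap ∘ₗ s)) (by
      rintro _ ⟨c, b, a, rfl⟩
      ext h
      simp only [map_sub, TensorProduct.lift.tmul, LinearMap.sub_apply, LinearMap.zero_apply,
        LinearMap.comp_apply, LinearEquiv.coe_coe, TensorProduct.lift.equiv_symm_apply]
      rw [sub_eq_zero, ← hsb]
      simp)
  refine ⟨TensorProduct.lift X, ?_⟩
  intro c x
  rw [← hs]
  generalize chi0 k A H δ x = w
  induction w with
  | zero => simp
  | add x y hx hy => simp only [map_add, hx, hy]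
  | tmul x y =>
    simp only [rTensor_tmul, TensorProduct.lift.tmul, jm_apply, hX, LinearMap.comp_apply,
      LinearEquiv.coe_coe, TensorProduct.lift.equiv_symm_apply]

end Core
end PaperAux
namespace PaperAux
open Paper
section Fin
variable {k A C H P : Type*} [Field k] [Ring A] [Algebra k A] [Ring C] [Algebra k C]
  [AddCommGroup P] [Module k P] [Ring H] [HopfAlgebra k H]

lemma db_e (δ : A →ₐ[k] A ⊗[k] H) (π : C ⊗[k] A →ₗ[k] P) (db : P →ₗ[k] P ⊗[k] H)
    (hdb : ∀ x : C ⊗[k] A, db (π x) = rTensor H π (coactT k A C H δ x)) (c : C) :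
    db (π (c ⊗ₜ 1)) = π (c ⊗ₜ 1) ⊗ₜ 1 := by
  rw [db_eq δ π db hdb, map_one, Algebra.TensorProduct.one_def, rTensor_tmul, jm_apply]

lemma coinv_sub (δ : A →ₐ[k] A ⊗[k] H)
    (χ : ((A ⊗[k] A) ⧸ galSpan k A H δ) ≃ₗ[k] A ⊗[k] H)
    (hχ : ∀ x : A ⊗[k] A, χ (galQ k A H δ x) = chi0 k A H δ x)
    (hff : IsFaithfullyFlatLeft (coinv k A H δ) A)
    (F : coinv k A H δ →ₐ[k] C) (π : C ⊗[k] A →ₗ[k] P)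
    (hπ : Function.Surjective π) (hker : LinearMap.ker π = relSpan k A C (coinv k A H δ) F)
    (hrel : ∀ c (b : coinv k A H δ) a, π (c ⊗ₜ ((b : A) * a)) = π ((c * F b) ⊗ₜ a))
    (db : P →ₗ[k] P ⊗[k] H)
    (hdb : ∀ x : C ⊗[k] A, db (π x) = rTensor H π (coactT k A C H δ x))
    (p : P) (hp : db p = p ⊗ₜ 1) : ∃ c, π (c ⊗ₜ 1) = p := by
  obtain ⟨rm, hrm⟩ := exists_rm (coinv k A H δ) F π hπ hker hrel
  have hrm' : ∀ c a a', rm (π (c ⊗ₜ a)) a' = π (c ⊗ₜ (a * a')) := by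
    intro c a a'; rw [hrm]; simp
  let E : Submodule k P := LinearMap.range (π ∘ₗ (TensorProduct.mk k C A).flip 1)
  have hE : ∀ c, π (c ⊗ₜ 1) ∈ E := fun c => ⟨c, rfl⟩
  suffices hpE : E.mkQ p = 0 by
    have hpE' : p ∈ E := (Submodule.Quotient.mk_eq_zero E).1 hpE
    obtain ⟨c, hc⟩ := hpE'
    exact ⟨c, hc⟩
  let rB : P →ₗ[k] coinv k A H δ →ₗ[k] P := rm.compl₂ (coinv k A H δ).val.toLinearMap
  have hrB : ∀ x b, rB x b = rm x (b : A) := fun x b => rfl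
  let ρ : (P ⧸ E) →ₗ[k] coinv k A H δ →ₗ[k] (P ⧸ E) := E.liftQ (rB.compr₂ E.mkQ) (by
    rintro _ ⟨c, rfl⟩
    rw [LinearMap.mem_ker]
    ext b
    simp only [LinearMap.compr₂_apply, hrB, LinearMap.comp_apply, LinearMap.flip_apply,
      TensorProduct.mk_apply, LinearMap.zero_apply, hrm', one_mul]
    have e : π (c ⊗ₜ (b : A)) = π ((c * F b) ⊗ₜ 1) := by rw [← hrel, mul_one]
    rw [e]
    exact (Submodule.Quotient.mk_eq_zero E).2 (hE _))
  have hρ : ∀ x b, ρ (E.mkQ x) b = E.mkQ (rm x (b : A)) := fun x b => rfl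
  have hrmm : ∀ x a a', rm (rm x a) a' = rm x (a * a') := by
    intro x a a'
    obtain ⟨z, rfl⟩ := hπ x
    induction z with
    | zero => simp
    | add x y hx hy => simp only [map_add, LinearMap.add_apply, hx, hy]
    | tmul c u => simp only [hrm', mul_assoc]
  have hrm1 : ∀ x, rm x 1 = x := by
    intro x
    obtain ⟨z, rfl⟩ := hπ x
    induction z with
    | zero => simp
    | add x y hx hy => simp only [map_add, LinearMap.add_apply, hx, hy]
    | tmul c u => simp only [hrm', mul_one]
  apply ff_zero hff ρ
  · intro n r s
    obtain ⟨x, rfl⟩ := E.mkQ_surjective n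
    rw [hρ, hρ, hρ, hrmm]; rfl
  · intro n
    obtain ⟨x, rfl⟩ := E.mkQ_surjective n
    rw [hρ]
    exact congrArg _ (hrm1 x)
  intro a
  let TT := tSpan A ρ
  -- `g x a' = [x ⊗ a' a]`
  let g : P →ₗ[k] A →ₗ[k] (((P ⧸ E) ⊗[k] A) ⧸ TT) :=
    (((TensorProduct.mk k (P ⧸ E) A).compl₁₂ E.mkQ (LinearMap.mulRight k a))).compr₂ TT.mkQ
  have hg : ∀ x a', g x a' = TT.mkQ (E.mkQ x ⊗ₜ (a' * a)) := fun x a' => rfl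
  obtain ⟨Ξ, hΞ⟩ := exists_Xi δ χ hχ F π hπ hker hrel g (by
    intro c u b v
    rw [hg, hg, ← hrm', ← hρ, eq_comm, ← sub_eq_zero, ← map_sub]
    refine (Submodule.Quotient.mk_eq_zero TT).2 (Submodule.subset_span ?_)
    exact ⟨E.mkQ (π (c ⊗ₜ u)), b, v * a, by rw [mul_assoc]; rfl⟩)
  have h1 : Ξ ∘ₗ db = 0 := by
    apply P_ext hπ
    intro c u
    have e : δ u = chi0 k A H δ (1 ⊗ₜ u) := by
      rw [chi0_tmul, LinearMap.mulLeft_one, LinearMap.rTensor_id_apply]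
    rw [LinearMap.comp_apply, db_eq δ π db hdb, e, hΞ, TensorProduct.lift.tmul,
      LinearMap.comp_apply, jm_apply, hg]
    have : E.mkQ (π (c ⊗ₜ 1)) = 0 := (Submodule.Quotient.mk_eq_zero E).2 (hE _)
    rw [this, TensorProduct.zero_tmul]; simp
  have h2 : Ξ ∘ₗ (TensorProduct.mk k P H).flip 1 = g.flip 1 := by
    apply P_ext hπ
    intro c u
    have e : π (c ⊗ₜ u) ⊗ₜ (1 : H) = rTensor H (jm π c) (chi0 k A H δ (u ⊗ₜ 1)) := by
      rw [chi0_tmul, map_one, Algebra.TensorProduct.one_def]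
      simp [jm_apply]
    rw [LinearMap.comp_apply, LinearMap.flip_apply, TensorProduct.mk_apply, e, hΞ]
    rfl
  have h3 := LinearMap.congr_fun h2 p
  rw [LinearMap.comp_apply, LinearMap.flip_apply, TensorProduct.mk_apply, ← hp,
    ← LinearMap.comp_apply, h1, LinearMap.flip_apply, hg, one_mul] at h3
  exact (Submodule.Quotient.mk_eq_zero TT).1 h3.symm

lemma galois (δ : A →ₐ[k] A ⊗[k] H)
    (χ : ((A ⊗[k] A) ⧸ galSpan k A H δ) ≃ₗ[k] A ⊗[k] H)
    (hχ : ∀ x : A ⊗[k] A, χ (galQ k A H δ x) = chi0 k A H δ x)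
    (F : coinv k A H δ →ₐ[k] C) (π : C ⊗[k] A →ₗ[k] P)
    (hπ : Function.Surjective π) (hker : LinearMap.ker π = relSpan k A C (coinv k A H δ) F)
    (hrel : ∀ c (b : coinv k A H δ) a, π (c ⊗ₜ ((b : A) * a)) = π ((c * F b) ⊗ₜ a))
    (ψ : A ⊗[k] C →ₗ[k] C ⊗[k] A) (hψ : IsTwistingMap k A C ψ)
    (hcomod : IsComodMor k A C H δ ψ)
    (hbar : ∀ (b : coinv k A H δ) (a : A) (c : C),
      π (ψ (a ⊗ₜ (c * F b))) = π (lTensor C (LinearMap.mulRight k (b : A)) (ψ (a ⊗ₜ c))))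
    (hn1 : ∀ c : C, π (ψ ((1 : A) ⊗ₜ c)) = π (c ⊗ₜ (1 : A)))
    (hn2 : ∀ a : A, π (ψ (a ⊗ₜ (1 : C))) = π ((1 : C) ⊗ₜ a))
    (m : P →ₗ[k] P →ₗ[k] P) (hm : ∀ x y, m (π x) (π y) = π (Paper.tmul k A C ψ x y))
    (db : P →ₗ[k] P ⊗[k] H)
    (hdb : ∀ x : C ⊗[k] A, db (π x) = rTensor H π (coactT k A C H δ x))
    (e : C → P) (he : ∀ c, e c = π (c ⊗ₜ 1)) :
    ∃ echi : ((P ⊗[k] P) ⧸ balSpan m e) →ₗ[k] P ⊗[k] H,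
        (∀ z, echi ((balSpan m e).mkQ z) = chiP m db z) ∧ Function.Bijective echi := by
  obtain ⟨rm, hrm⟩ := exists_rm (coinv k A H δ) F π hπ hker hrel
  have hrm' : ∀ c a a', rm (π (c ⊗ₜ a)) a' = π (c ⊗ₜ (a * a')) := by
    intro c a a'; rw [hrm]; simp
  choose lm hlm using exists_lm (coinv k A H δ) F π hπ hker hrel
  have hlm' : ∀ c c' a, lm c (π (c' ⊗ₜ a)) = π ((c * c') ⊗ₜ a) := by
    intro c a a'; rw [hlm]; simp
  have hmul : ∀ c a c' a', m (π (c ⊗ₜ a)) (π (c' ⊗ₜ a')) = rm (lm c (π (ψ (a ⊗ₜ c')))) a' := by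
    intro c a c' a'
    rw [hm, tmul_eq, hlm, hrm]
  have hmul1 : ∀ c c' a', m (π (c ⊗ₜ 1)) (π (c' ⊗ₜ a')) = π ((c * c') ⊗ₜ a') := by
    intro c c' a'
    rw [hmul, hn1, hlm', hrm', one_mul]
  have hmul2 : ∀ c a a', m (π (c ⊗ₜ a)) (π (1 ⊗ₜ a')) = π (c ⊗ₜ (a * a')) := by
    intro c a a'
    rw [hmul, hn2, hlm', hrm', mul_one]
  have hmul3 : ∀ c a (b : coinv k A H δ), m (π (c ⊗ₜ a)) (π (F b ⊗ₜ 1)) = π (c ⊗ₜ (a * b)) := by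
    intro c a b
    have h1 := hbar b a 1
    rw [one_mul, ← hrm, hn2, hrm'] at h1
    rw [hmul, h1, hlm', hrm', mul_one, mul_one]
  have hassoc : ∀ x y z, m (m x y) z = m x (m y z) := by
    intro x y z
    obtain ⟨x, rfl⟩ := hπ x
    obtain ⟨y, rfl⟩ := hπ y
    obtain ⟨z, rfl⟩ := hπ z
    rw [hm, hm, hm, hm, hψ]
  let S := balSpan m e
  let echi : ((P ⊗[k] P) ⧸ S) →ₗ[k] P ⊗[k] H := S.liftQ (chiP m db) (by
    refine Submodule.span_le.2 ?_
    rintro _ ⟨x, y, c, rfl⟩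
    change chiP m db _ = 0
    rw [map_sub, chiP_tmul, chiP_tmul, db_mul δ ψ hcomod π hπ m hm db hdb, he,
      db_e δ π db hdb, sub_eq_zero]
    generalize db y = w
    induction w with
    | zero => simp
    | add x y hx hy => simp only [map_add, hx, hy]
    | tmul u v =>
      simp only [rTensor_tmul, tmulH, TensorProduct.map₂_apply_tmul, TensorProduct.map_tmul,
        LinearMap.mul_apply', one_mul, hassoc])
  have hechi : ∀ z, echi (S.mkQ z) = chiP m db z := fun z => rfl
  refine ⟨echi, hechi, ?_⟩
  let g : P →ₗ[k] A →ₗ[k] ((P ⊗[k] P) ⧸ S) :=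
    ((TensorProduct.mk k P P).compl₂ (jm π 1)).compr₂ S.mkQ
  have hg : ∀ x a, g x a = S.mkQ (x ⊗ₜ π (1 ⊗ₜ a)) := fun x a => rfl
  have hbal : ∀ x c y, S.mkQ (m x (π (c ⊗ₜ 1)) ⊗ₜ y) = S.mkQ (x ⊗ₜ m (π (c ⊗ₜ 1)) y) := by
    intro x c y
    rw [← sub_eq_zero, ← map_sub]
    refine (Submodule.Quotient.mk_eq_zero S).2 (Submodule.subset_span ?_)
    exact ⟨x, y, c, by rw [he]⟩
  obtain ⟨Ξ, hΞ⟩ := exists_Xi δ χ hχ F π hπ hker hrel g (by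
    intro c u b v
    rw [hg, hg, ← hmul3, hbal, hmul1, hrel, mul_one, one_mul])
  have hchi : ∀ c a a', chiP m db (π (c ⊗ₜ a) ⊗ₜ π (1 ⊗ₜ a')) =
      rTensor H (jm π c) (chi0 k A H δ (a ⊗ₜ a')) := by
    intro c a a'
    rw [chiP_tmul, db_eq δ π db hdb, chi0_tmul]
    generalize δ a' = w
    induction w with
    | zero => simp
    | add x y hx hy => simp only [map_add, hx, hy]
    | tmul u v => simp only [rTensor_tmul, jm_apply, hmul2, LinearMap.mulLeft_apply]
  have hsurj : ∀ w, ∃ x, chi0 k A H δ x = w := by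
    intro w
    obtain ⟨x, hx⟩ := Submodule.mkQ_surjective _ (χ.symm w)
    refine ⟨x, ?_⟩
    rw [← hχ]
    exact (congrArg χ hx).trans (χ.apply_symm_apply w)
  have hleft : ∀ z, Ξ (echi z) = z := by
    intro z
    obtain ⟨z, rfl⟩ := S.mkQ_surjective z
    rw [hechi]
    induction z with
    | zero => simp
    | add x y hx hy => simp only [map_add, hx, hy]
    | tmul x y =>
      have key : ∀ x a', Ξ (chiP m db (x ⊗ₜ π (1 ⊗ₜ a'))) = S.mkQ (x ⊗ₜ π (1 ⊗ₜ a')) := by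
        intro x a'
        obtain ⟨x, rfl⟩ := hπ x
        induction x with
        | zero => simp
        | add x y hx hy => simp only [map_add, TensorProduct.add_tmul, hx, hy]
        | tmul c a =>
          rw [hchi, hΞ]; rfl
      obtain ⟨y, rfl⟩ := hπ y
      induction y with
      | zero => simp
      | add x y hx hy => simp only [map_add, TensorProduct.tmul_add, hx, hy]
      | tmul c a =>
        have e1 : S.mkQ (x ⊗ₜ π (c ⊗ₜ a)) = S.mkQ (m x (π (c ⊗ₜ 1)) ⊗ₜ π (1 ⊗ₜ a)) := by
          rw [hbal, hmul1, mul_one]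
        rw [← hechi, e1, hechi, key]
  have hright : ∀ c x, echi (Ξ (rTensor H (jm π c) (chi0 k A H δ x))) =
      rTensor H (jm π c) (chi0 k A H δ x) := by
    intro c x
    rw [hΞ]
    induction x with
    | zero => simp
    | add x y hx hy => simp only [map_add, hx, hy]
    | tmul a a' =>
      rw [← hchi, ← hechi]; rfl
  refine ⟨fun x y hxy => by rw [← hleft x, hxy, hleft], ?_⟩
  intro w
  refine ⟨Ξ w, ?_⟩
  induction w with
  | zero => simp
  | add x y hx hy => simp only [map_add, hx, hy]
  | tmul p h =>
    obtain ⟨z, rfl⟩ := hπ p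
    induction z with
    | zero => simp
    | add x y hx hy => simp only [map_add, TensorProduct.add_tmul, hx, hy]
    | tmul c a =>
      obtain ⟨x, hx⟩ := hsurj (a ⊗ₜ h)
      have := hright c x
      rw [hx] at this
      simpa [jm_apply] using this

lemma ff_push (B : Subalgebra k A) (hff : IsFaithfullyFlatLeft B A)
    (F : B →ₐ[k] C) (π : C ⊗[k] A →ₗ[k] P)
    (hπ : Function.Surjective π) (hker : LinearMap.ker π = relSpan k A C B F)
    (hrel : ∀ c (b : B) a, π (c ⊗ₜ ((b : A) * a)) = π ((c * F b) ⊗ₜ a))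
    [Module C P]
    (hsm : ∀ (c : C) (x : C ⊗[k] A), c • π x = π (rTensor A (LinearMap.mulLeft k c) x)) :
    IsFaithfullyFlatLeft C P := by
  have hsm' : ∀ c c' a, c • π (c' ⊗ₜ a) = π ((c * c') ⊗ₜ a) := by
    intro c c' a; rw [hsm]; simp
  refine ⟨?_, ?_⟩
  · intro n r x hx
    choose z hz using fun i => hπ (x i)
    choose T hT using fun i => TensorProduct.exists_finset (z i)
    let ι := Σ i : Fin n, T i
    let cc : ι → C := fun l => (l.2 : C × A).1
    let aa : ι → A := fun l => (l.2 : C × A).2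
    let ρ : C →ₗ[k] B →ₗ[k] C := (LinearMap.mul k C).compl₂ F.toLinearMap
    have hρ : ∀ c b, ρ c b = c * F b := fun c b => rfl
    have hspan : ∑ l : ι, (r l.1 * cc l) ⊗ₜ[k] aa l ∈ tSpan A ρ := by
      have e1 : tSpan A ρ = LinearMap.ker π := by rw [hker]; rfl
      rw [e1, LinearMap.mem_ker, map_sum, ← hx, Fintype.sum_sigma]
      apply Finset.sum_congr rfl
      intro i _
      rw [← hz i, hT i, map_sum, Finset.smul_sum, ← Finset.sum_coe_sort (T i)]
      apply Finset.sum_congr rfl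
      intro l _
      rw [hsm']
    obtain ⟨q, b, y, h1, h2⟩ := vanish hff.1 ρ (by intro c r s; simp [hρ, mul_assoc])
      (by intro c; simp [hρ]) (fun l : ι => r l.1 * cc l) aa hspan
    refine ⟨q, fun i j => ∑ l : T i, (l : C × A).1 * F (b ⟨i, l⟩ j), fun j => π (1 ⊗ₜ y j), ?_, ?_⟩
    · intro i
      rw [← hz i, hT i, map_sum, ← Finset.sum_coe_sort (T i)]
      simp only [Finset.sum_smul]
      rw [Finset.sum_comm]
      apply Finset.sum_congr rfl
      intro l _
      have e2 : (l : C × A).2 = ∑ j, b ⟨i, l⟩ j • y j := h1 ⟨i, l⟩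
      rw [e2, TensorProduct.tmul_sum, map_sum]
      apply Finset.sum_congr rfl
      intro j _
      rw [hsm', mul_one]
      exact hrel _ _ _
    · intro j
      have h3 := h2 j
      rw [Fintype.sum_sigma] at h3
      rw [← h3]
      apply Finset.sum_congr rfl
      intro i _
      rw [Finset.mul_sum]
      apply Finset.sum_congr rfl
      intro l _
      rw [hρ, mul_assoc]
  · intro I hI htop
    let I' : Submodule k C :=
      { carrier := I
        add_mem' := fun ha hb => I.add_mem ha hb
        zero_mem' := I.zero_mem
        smul_mem' := by
          intro c x hx
          have := I.smul_mem (MulOpposite.op (algebraMap k C c)) hx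
          rw [op_smul_eq_mul, ← Algebra.commutes, ← Algebra.smul_def] at this
          exact this }
    have hmem : ∀ i, i ∈ I' ↔ i ∈ I := fun i => Iff.rfl
    have hIr : ∀ i ∈ I', ∀ c, i * c ∈ I' := by
      intro i hi c
      have := I.smul_mem (MulOpposite.op c) hi
      rwa [op_smul_eq_mul] at this
    have hq0 : ∀ i ∈ I', I'.mkQ i = 0 := fun i hi => (Submodule.Quotient.mk_eq_zero I').2 hi
    let ρ0 : C →ₗ[k] B →ₗ[k] C := (LinearMap.mul k C).compl₂ F.toLinearMap
    let ρ : (C ⧸ I') →ₗ[k] B →ₗ[k] (C ⧸ I') := I'.liftQ (ρ0.compr₂ I'.mkQ) (by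
      intro i hi
      rw [LinearMap.mem_ker]
      ext b
      exact hq0 _ (hIr i hi _))
    have hρ : ∀ c b, ρ (I'.mkQ c) b = I'.mkQ (c * F b) := fun c b => rfl
    have h1 : I'.mkQ (1 : C) = 0 := by
      apply ff_zero hff ρ
      · intro n r s
        obtain ⟨c, rfl⟩ := I'.mkQ_surjective n
        rw [hρ, hρ, hρ, map_mul F, mul_assoc]
      · intro n
        obtain ⟨c, rfl⟩ := I'.mkQ_surjective n
        rw [hρ, map_one, mul_one]
      intro a
      let TT := tSpan A ρ
      obtain ⟨f, hf⟩ := exists_desc π hπ _ hker (TT.mkQ ∘ₗ rTensor A I'.mkQ) (by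
        rintro _ ⟨c, b, a, rfl⟩
        rw [LinearMap.comp_apply, map_sub, rTensor_tmul, rTensor_tmul, ← hρ]
        refine (Submodule.Quotient.mk_eq_zero TT).2 (Submodule.subset_span ?_)
        exact ⟨_, _, _, rfl⟩)
      have hall : ∀ v, f v = 0 := by
        intro v
        have hv : v ∈ AddSubgroup.closure {z : P | ∃ i ∈ I, ∃ v : P, z = i • v} := by
          rw [htop]; trivial
        induction hv using AddSubgroup.closure_induction with
        | mem x hx =>
          obtain ⟨i, hi, v, rfl⟩ := hx
          obtain ⟨z, rfl⟩ := hπ v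
          rw [hsm, hf]
          induction z with
          | zero => simp
          | add x y hx hy => simp only [map_add, hx, hy, add_zero]
          | tmul c u =>
            rw [rTensor_tmul, LinearMap.comp_apply, rTensor_tmul, LinearMap.mulLeft_apply,
              hq0 _ (hIr i hi c), TensorProduct.zero_tmul, map_zero]
        | zero => simp
        | add x y _ _ hx hy => rw [map_add, hx, hy, add_zero]
        | neg x _ hx => rw [map_neg, hx, neg_zero]
      have h2 := hall (π (1 ⊗ₜ a))
      rw [hf] at h2
      exact (Submodule.Quotient.mk_eq_zero TT).1 h2
    have h1I : (1 : C) ∈ I' := (Submodule.Quotient.mk_eq_zero I').1 h1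
    apply hI.1
    rw [eq_top_iff]
    intro c _
    have := hIr 1 h1I c
    rwa [one_mul] at this

end Fin
end PaperAux

open Paper in
/-- push-forward theorem: if `B ⊆ A` is an `H`-Galois extension with `A`
faithfully flat over `B`, and `ψ` is a twisting map, `H`-comodule morphism, with `\barψ` a
`B`-bimodule morphism which is normal and satisfies the distributive law, then the twisted
push-forward algebra `C ⊗^ψ_B A` is a right `H`-comodule algebra whose coinvariants are
exactly `C`, the extension `C ⊆ C ⊗^ψ_B A` is `H`-Galois, and `C ⊗_B A` is faithfully flat
as a left `C`-module. -/
theorem pushforward_HopfGalois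
    (k : Type*) [Field k] (A : Type*) [Ring A] [Algebra k A]
    (C : Type*) [Ring C] [Algebra k C] (H : Type*) [Ring H] [HopfAlgebra k H]
    (δ : A →ₐ[k] A ⊗[k] H) (hδ : IsComodAlg k A H δ)
    -- `B ⊆ A` is `H`-Galois:
    (χ : ((A ⊗[k] A) ⧸ galSpan k A H δ) ≃ₗ[k] A ⊗[k] H)
    (hχ : ∀ x : A ⊗[k] A, χ (galQ k A H δ x) = chi0 k A H δ x)
    -- `A` is faithfully flat as a left `B`-module:
    (hff : IsFaithfullyFlatLeft (coinv k A H δ) A)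
    (F : coinv k A H δ →ₐ[k] C)
    (ψ : A ⊗[k] C →ₗ[k] C ⊗[k] A) (hψ : IsTwistingMap k A C ψ)
    (hcomod : IsComodMor k A C H δ ψ)
    (hbar : BarBimod k A C H δ F ψ) (hnor : BarNormal k A C H δ F ψ)
    (σ : C →ₗ[k] ((C ⊗[k] A) ⧸ pushSpan k A C H δ F)
      →ₗ[k] ((C ⊗[k] A) ⧸ pushSpan k A C H δ F))
    (hσ : SigmaSpec k A C H δ F σ) (hdist : BarDistrib k A C H δ F ψ σ)
    -- the induced multiplication on `C ⊗_B A`: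
    (m : ((C ⊗[k] A) ⧸ pushSpan k A C H δ F) →ₗ[k]
      ((C ⊗[k] A) ⧸ pushSpan k A C H δ F) →ₗ[k] ((C ⊗[k] A) ⧸ pushSpan k A C H δ F))
    (hm : ∀ x y : C ⊗[k] A,
      m (pushQ k A C H δ F x) (pushQ k A C H δ F y) = pushQ k A C H δ F (tmul k A C ψ x y))
    -- the induced coaction `id_C ⊗_B δ`:
    (db : ((C ⊗[k] A) ⧸ pushSpan k A C H δ F) →ₗ[k]
      ((C ⊗[k] A) ⧸ pushSpan k A C H δ F) ⊗[k] H)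
    (hdb : ∀ x : C ⊗[k] A,
      db (pushQ k A C H δ F x) = rTensor H (pushQ k A C H δ F) (coactT k A C H δ x))
    -- the left `C`-module structure on `C ⊗_B A`:
    [instM : Module C ((C ⊗[k] A) ⧸ pushSpan k A C H δ F)]
    (hsm : ∀ (c : C) (x : C ⊗[k] A),
      c • pushQ k A C H δ F x = pushQ k A C H δ F (rTensor A (LinearMap.mulLeft k c) x)) :
    -- `C ⊗^ψ_B A` is a right `H`-comodule algebra:
    ((∀ p q, db (m p q) = tmulH m (db p) (db q))
      ∧ db (pushQ k A C H δ F ((1 : C) ⊗ₜ (1 : A)))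
          = pushQ k A C H δ F ((1 : C) ⊗ₜ (1 : A)) ⊗ₜ (1 : H)
      ∧ Coassoc db ∧ Counital db)
    -- whose coinvariant subalgebra is exactly `C`:
    ∧ {p : (C ⊗[k] A) ⧸ pushSpan k A C H δ F | db p = p ⊗ₜ (1 : H)}
        = Set.range (eC k A C H δ F)
    -- and the extension `C ⊆ C ⊗^ψ_B A` is `H`-Galois:
    ∧ (∃ echi : ((((C ⊗[k] A) ⧸ pushSpan k A C H δ F) ⊗[k]
          ((C ⊗[k] A) ⧸ pushSpan k A C H δ F)) ⧸ balSpan m (eC k A C H δ F)) →ₗ[k]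
            ((C ⊗[k] A) ⧸ pushSpan k A C H δ F) ⊗[k] H,
        (∀ z, echi ((balSpan m (eC k A C H δ F)).mkQ z) = chiP m db z)
        ∧ Function.Bijective echi)
    -- and `C ⊗_B A` is faithfully flat as a left `C`-module:
    ∧ IsFaithfullyFlatLeft C ((C ⊗[k] A) ⧸ pushSpan k A C H δ F) := by
  have hπ : Function.Surjective (pushQ k A C H δ F) := Submodule.mkQ_surjective _
  have hker : LinearMap.ker (pushQ k A C H δ F) = relSpan k A C (coinv k A H δ) F :=
    Submodule.ker_mkQ _
  have hrel : ∀ c (b : coinv k A H δ) a, pushQ k A C H δ F (c ⊗ₜ ((b : A) * a)) =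
      pushQ k A C H δ F ((c * F b) ⊗ₜ a) := by
    intro c b a
    rw [← sub_eq_zero, ← map_sub, ← LinearMap.mem_ker, hker]
    exact Submodule.subset_span ⟨c, b, a, rfl⟩
  refine ⟨⟨?_, ?_, ?_, ?_⟩, ?_, ?_, ?_⟩
  · exact PaperAux.db_mul δ ψ hcomod _ hπ m hm db hdb
  · exact PaperAux.db_e δ _ db hdb 1
  · exact PaperAux.db_coassoc δ hδ _ hπ db hdb
  · exact PaperAux.db_counital δ hδ _ hπ db hdb
  · ext p
    constructor
    · intro hp
      exact PaperAux.coinv_sub δ χ hχ hff F _ hπ hker hrel db hdb p hp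
    · rintro ⟨c, rfl⟩
      exact PaperAux.db_e δ _ db hdb c
  · exact PaperAux.galois δ χ hχ F _ hπ hker hrel ψ hψ hcomod hbar.2 hnor.1 hnor.2 m hm db hdb
      _ (fun c => rfl)
  · exact PaperAux.ff_push (coinv k A H δ) hff F _ hπ hker hrel hsm
end
end

section
/- Let {C, A} be a matched pair of bialgebras over k. Let A also be a right H-Galois object for a Hopf algebra H, with coaction δ: A → A⊗H, and faithfully flat as a k-module. Suppose the comultiplication Δ_A: A → A⊗A is a right H-comodule morphism (for A⊗A with coaction id_A⊗δ) and the right action ◁: A⊗C → A is a right H-comodule morphism (for A⊗C with coaction (id_A⊗flip)∘(δ⊗id_C), i.e. δ(a◁c) = (a₍₀₎◁c)⊗a₍₁₎). Then the double crossed product algebra C⋈A is a faithfully flat H-Galois extension of C. -/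
open TensorProduct LinearMap Function

noncomputable section
namespace DCP
open Paper Coalgebra

section flat
theorem ff_left (k : Type*) [Field k] (A : Type*) [Ring A] [Algebra k A] [Nontrivial A]
    (C : Type*) [Ring C] [Algebra k C] : IsFaithfullyFlatLeft C (C ⊗[k] A) := by
  classical
  let b0 := Module.Basis.ofVectorSpace k A
  let b := Algebra.TensorProduct.basis C b0
  constructor
  · intro n r x h
    let s : Finset _ := Finset.univ.biUnion (fun i : Fin n => (b.repr (x i)).support)
    let e := s.equivFin
    refine ⟨s.card, fun i j => b.repr (x i) (e.symm j), fun j => b (e.symm j), ?_, ?_⟩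
    · intro i
      rw [Equiv.sum_comp e.symm (fun j : s => b.repr (x i) j • b j),
        Finset.sum_coe_sort s (fun j => b.repr (x i) j • b j)]
      conv_lhs => rw [← b.linearCombination_repr (x i), Finsupp.linearCombination_apply, Finsupp.sum]
      apply Finset.sum_subset
      · intro j hj
        exact Finset.mem_biUnion.2 ⟨i, Finset.mem_univ _, hj⟩
      · intro j _ hj
        rw [Finsupp.notMem_support_iff.1 hj, zero_smul]
    · intro j
      have := congrArg (fun z => b.repr z (e.symm j)) h
      simpa [map_sum, Finsupp.finsetSum_apply] using this
  · intro I hI htop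
    have hne : Nonempty (Module.Basis.ofVectorSpaceIndex k A) := b0.index_nonempty
    obtain ⟨j⟩ := hne
    have key : ∀ z : C ⊗[k] A, b.repr z j ∈ I := by
      intro z
      have hz : z ∈ AddSubgroup.closure
          {z : C ⊗[k] A | ∃ i ∈ I, ∃ v : C ⊗[k] A, z = i • v} := by rw [htop]; trivial
      induction hz using AddSubgroup.closure_induction with
      | mem z hz =>
        obtain ⟨i, hi, v, rfl⟩ := hz
        have := I.smul_mem (MulOpposite.op (b.repr v j)) hi
        simpa using this
      | zero => simp
      | add x y _ _ hx hy => simpa using I.add_mem hx hy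
      | neg x _ hx => simpa using I.neg_mem hx
    apply hI.1
    rw [eq_top_iff]
    intro c _
    have := key (c • b j)
    simpa using this
end flat

section coinvs
theorem coinv_tensor (k : Type*) [Field k] (A : Type*) [Ring A] [Algebra k A]
    (C : Type*) [Ring C] [Algebra k C] (H : Type*) [Ring H] [HopfAlgebra k H]
    (δ : A →ₐ[k] A ⊗[k] H) (hco : coinv k A H δ = ⊥) :
    {x : C ⊗[k] A | coactT k A C H δ x = x ⊗ₜ (1 : H)}
          = Set.range (fun c : C => c ⊗ₜ (1 : A)) := by
  ext x
  constructor
  · intro hx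
    let g : A →ₗ[k] A ⊗[k] H := δ.toLinearMap - (TensorProduct.mk k A H).flip 1
    have hex : Function.Exact (Algebra.linearMap k A) g := by
      intro a
      have h1 : g a = 0 ↔ a ∈ coinv k A H δ := by
        simp only [g, LinearMap.sub_apply, sub_eq_zero]
        rfl
      rw [h1, hco, Algebra.mem_bot]
      rfl
    have hex2 := Module.Flat.lTensor_exact C hex
    have : lTensor C g x = 0 := by
      have h2 : ∀ y : C ⊗[k] A, (TensorProduct.assoc k C A H).symm (lTensor C g y)
          = coactT k A C H δ y - y ⊗ₜ (1 : H) := by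
        intro y
        induction y with
        | zero => simp
        | add y z hy hz => simp only [map_add, hy, hz, add_tmul]; abel
        | tmul c a => simp [g, coactT, tmul_sub]
      have h3 := h2 x
      rw [show coactT k A C H δ x = x ⊗ₜ (1 : H) from hx, sub_self] at h3
      simpa using h3
    obtain ⟨y, rfl⟩ := (hex2 x).1 this
    refine ⟨TensorProduct.rid k C y, ?_⟩
    clear hx this
    induction y with
    | zero => simp
    | add y z hy hz =>
      simp only [map_add, add_tmul] at hy hz ⊢
      rw [hy, hz]
    | tmul c r => simp [Algebra.algebraMap_eq_smul_one, smul_tmul]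
  · rintro ⟨c, rfl⟩
    simp [coactT, Algebra.TensorProduct.one_def]
end coinvs

section mult
variable {k : Type*} [Field k] {A : Type*} [Ring A] [Algebra k A]
    {C : Type*} [Ring C] [Algebra k C] {H : Type*} [Ring H] [HopfAlgebra k H]
    (ψ : A ⊗[k] C →ₗ[k] C ⊗[k] A) (δ : A →ₐ[k] A ⊗[k] H)

theorem tmulMap_tmul (c c' : C) (a a' : A) :
    tmulMap k A C ψ ((c ⊗ₜ a) ⊗ₜ (c' ⊗ₜ a')) =
      TensorProduct.map (LinearMap.mulLeft k c) (LinearMap.mulRight k a') (ψ (a ⊗ₜ c')) := by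
  simp only [tmulMap, LinearMap.comp_apply, LinearEquiv.coe_coe, TensorProduct.assoc_symm_tmul,
    TensorProduct.map_tmul, TensorProduct.assoc_tmul, LinearMap.lTensor_tmul, LinearMap.id_apply]
  induction ψ (a ⊗ₜ c') with
  | zero => simp
  | add x y hx hy => simp only [tmul_add, add_tmul, map_add, hx, hy]
  | tmul d b => simp

theorem tmulMap_map (c c' : C) (z : C ⊗[k] A) (a' : A) :
    tmulMap k A C ψ ((TensorProduct.map (LinearMap.mulLeft k c) LinearMap.id z) ⊗ₜ (c' ⊗ₜ a')) =
      TensorProduct.map (LinearMap.mulLeft k c) (LinearMap.mulRight k a')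
        (tmulMap k A C ψ (z ⊗ₜ (c' ⊗ₜ 1))) := by
  induction z with
  | zero => simp
  | add x y hx hy => simp only [tmul_add, add_tmul, map_add, hx, hy]
  | tmul d b =>
    simp only [TensorProduct.map_tmul, tmulMap_tmul, LinearMap.mulLeft_apply, LinearMap.id_apply]
    induction ψ (b ⊗ₜ c') with
    | zero => simp
    | add x y hx hy => simp only [map_add, hx, hy]
    | tmul d b => simp [mul_assoc]

theorem assoc_mid (hR : RightNormal k A C ψ)
    (h2 : ∀ (a : A) (c c' : C), ψ (a ⊗ₜ (c * c')) = tmulMap k A C ψ (ψ (a ⊗ₜ c) ⊗ₜ (c' ⊗ₜ 1)))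
    (x y : C ⊗[k] A) (c : C) :
    tmulMap k A C ψ (tmulMap k A C ψ (x ⊗ₜ (c ⊗ₜ 1)) ⊗ₜ y)
      = tmulMap k A C ψ (x ⊗ₜ tmulMap k A C ψ ((c ⊗ₜ 1) ⊗ₜ y)) := by
  induction x with
  | zero => simp
  | add x y hx hy => simp only [tmul_add, add_tmul, map_add, hx, hy]
  | tmul d b =>
    induction y with
    | zero => simp
    | add x y hx hy => simp only [tmul_add, add_tmul, map_add, hx, hy]
    | tmul d' b' =>
      rw [tmulMap_tmul, tmulMap_tmul, hR d']
      simp only [TensorProduct.map_tmul, LinearMap.mulLeft_apply, LinearMap.mulRight_apply, one_mul,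
        LinearMap.mulRight_one]
      rw [tmulMap_map, tmulMap_tmul, h2]

theorem coact_mul
    (hm : IsComodMor k A C H δ ψ) (x y : C ⊗[k] A) :
    coactT k A C H δ (tmul k A C ψ x y)
            = tmulH (TensorProduct.curry (tmulMap k A C ψ))
                (coactT k A C H δ x) (coactT k A C H δ y) := by
  unfold Paper.tmul
  induction x with
  | zero => simp
  | add x y hx hy => simp only [tmul_add, add_tmul, map_add, hx, hy, LinearMap.add_apply]
  | tmul c a =>
    induction y with
    | zero => simp
    | add x y hx hy => simp only [tmul_add, add_tmul, map_add, hx, hy]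
    | tmul c' a' =>
      rw [tmulMap_tmul]
      have h := LinearMap.congr_fun hm (a ⊗ₜ c')
      simp only [LinearMap.comp_apply, LinearEquiv.coe_coe, rTensor_tmul] at h
      have e1 : ∀ z : C ⊗[k] A, coactT k A C H δ
          (TensorProduct.map (LinearMap.mulLeft k c) (LinearMap.mulRight k a') z) =
          (TensorProduct.assoc k C A H).symm (TensorProduct.map (LinearMap.mulLeft k c)
            (LinearMap.mulRight k (δ a')) (lTensor C δ.toLinearMap z)) := by
        intro z
        induction z with
        | zero => simp
        | add x y hx hy => simp only [map_add, hx, hy]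
        | tmul d b => simp [coactT]
      rw [e1, h]
      simp only [coactT, LinearMap.comp_apply, LinearEquiv.coe_coe, lTensor_tmul,
        AlgHom.toLinearMap_apply]
      generalize δ a = u
      generalize δ a' = v
      induction u with
      | zero => simp
      | add x y hx hy => simp only [tmul_add, add_tmul, map_add, hx, hy, LinearMap.add_apply]
      | tmul b h =>
        induction v with
        | zero => simp
        | add x y hx hy =>
          have hmr : LinearMap.mulRight k (x + y) = LinearMap.mulRight k x + LinearMap.mulRight k y :=
            LinearMap.ext fun z => mul_add z x y
          rw [hmr]
          simp only [tmul_add, map_add, ← hx, ← hy, TensorProduct.map_add_right,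
            LinearMap.add_apply]
        | tmul b' h' =>
          simp only [tmulH, TensorProduct.assoc_tmul, TensorProduct.assoc_symm_tmul, lTensor_tmul,
            LinearEquiv.coe_coe, TensorProduct.comm_tmul, rTensor_tmul, TensorProduct.map₂_apply_tmul, TensorProduct.map_tmul,
            TensorProduct.curry_apply, tmulMap_tmul, LinearMap.mul_apply']
          induction ψ (b ⊗ₜ c') with
          | zero => simp
          | add x y hx hy => simp only [add_tmul, map_add, hx, hy]
          | tmul d b => simp

theorem galois (hL : LeftNormal k A C ψ) (hR : RightNormal k A C ψ)
    (h2 : ∀ (a : A) (c c' : C), ψ (a ⊗ₜ (c * c')) = tmulMap k A C ψ (ψ (a ⊗ₜ c) ⊗ₜ (c' ⊗ₜ 1)))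
    (hgal : Function.Bijective (chi0 k A H δ)) :
    ∃ echi : (((C ⊗[k] A) ⊗[k] (C ⊗[k] A)) ⧸
            balSpan (TensorProduct.curry (tmulMap k A C ψ)) (fun c : C => c ⊗ₜ (1 : A)))
              →ₗ[k] (C ⊗[k] A) ⊗[k] H,
          (∀ z, echi ((balSpan (TensorProduct.curry (tmulMap k A C ψ))
              (fun c : C => c ⊗ₜ (1 : A))).mkQ z)
            = chiP (TensorProduct.curry (tmulMap k A C ψ)) (coactT k A C H δ) z)
          ∧ Function.Bijective echi := by
  set S := balSpan (TensorProduct.curry (tmulMap k A C ψ)) (fun c : C => c ⊗ₜ (1 : A)) with hS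
  set f := chiP (TensorProduct.curry (tmulMap k A C ψ)) (coactT k A C H δ) with hf
  have eC : ∀ (c c' : C) (a : A), tmulMap k A C ψ ((c ⊗ₜ 1) ⊗ₜ (c' ⊗ₜ a)) = (c * c') ⊗ₜ a := by
    intro c c' a
    rw [tmulMap_tmul, hR]; simp
  have hle : S ≤ LinearMap.ker f := by
    rw [hS, balSpan, Submodule.span_le]
    rintro _ ⟨x, y, c, rfl⟩
    simp only [SetLike.mem_coe, LinearMap.mem_ker, map_sub, sub_eq_zero, TensorProduct.curry_apply]
    have e1 : ∀ x y : C ⊗[k] A, f (x ⊗ₜ y) =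
      rTensor H (tmulMap k A C ψ ∘ₗ TensorProduct.mk k _ _ x) (coactT k A C H δ y) := by
      intro x y
      simp only [hf, chiP, LinearMap.comp_apply, LinearEquiv.coe_coe, lTensor_tmul]
      induction coactT k A C H δ y with
      | zero => simp
      | add x y hx hy => simp only [tmul_add, map_add, hx, hy]
      | tmul d b => simp
    have e2 : ∀ y : C ⊗[k] A, coactT k A C H δ (tmulMap k A C ψ ((c ⊗ₜ 1) ⊗ₜ y)) =
      rTensor H (tmulMap k A C ψ ∘ₗ TensorProduct.mk k _ _ (c ⊗ₜ 1)) (coactT k A C H δ y) := by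
      intro y
      induction y with
      | zero => simp
      | add x y hx hy => simp only [tmul_add, map_add, hx, hy]
      | tmul d b =>
        rw [eC]
        simp only [coactT, LinearMap.comp_apply, LinearEquiv.coe_coe, lTensor_tmul]
        induction δ.toLinearMap b with
        | zero => simp
        | add x y hx hy => simp only [tmul_add, map_add, hx, hy]
        | tmul d b => simp [eC]
    rw [e1, e1, e2, ← rTensor_comp_apply]
    congr 2
    apply LinearMap.ext
    intro z
    simp only [LinearMap.comp_apply, TensorProduct.mk_apply]
    exact assoc_mid ψ hR h2 x z c
  let echi := S.liftQ f hle
  refine ⟨echi, fun z => rfl, ?_⟩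
  let Φ0 : C ⊗[k] (A ⊗[k] A) →ₗ[k] (C ⊗[k] A) ⊗[k] (C ⊗[k] A) :=
    lTensor (C ⊗[k] A) (TensorProduct.mk k C A 1) ∘ₗ (TensorProduct.assoc k C A A).symm.toLinearMap
  have hΦs : Function.Surjective (S.mkQ ∘ₗ Φ0) := by
    rw [← LinearMap.range_eq_top, eq_top_iff]
    rintro q -
    obtain ⟨z, rfl⟩ := S.mkQ_surjective q
    induction z with
    | zero => simp
    | add x y hx hy => rw [map_add]; exact Submodule.add_mem _ hx hy
    | tmul x y =>
      induction y with
      | zero => simp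
      | add u v hx hy => rw [tmul_add, map_add]; exact Submodule.add_mem _ hx hy
      | tmul c a =>
        refine ⟨TensorProduct.assoc k C A A (tmulMap k A C ψ (x ⊗ₜ (c ⊗ₜ 1)) ⊗ₜ a), ?_⟩
        simp only [Φ0, LinearMap.comp_apply, LinearEquiv.coe_coe, LinearEquiv.symm_apply_apply,
          lTensor_tmul, TensorProduct.mk_apply]
        rw [← sub_eq_zero, ← map_sub, Submodule.mkQ_apply, Submodule.Quotient.mk_eq_zero]
        refine Submodule.subset_span ⟨x, 1 ⊗ₜ a, c, ?_⟩
        simp [eC]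
  have hcomp : (echi ∘ₗ (S.mkQ ∘ₗ Φ0)) =
      (TensorProduct.assoc k C A H).symm.toLinearMap ∘ₗ lTensor C (chi0 k A H δ) := by
    ext c a a'
    change f (Φ0 (c ⊗ₜ (a ⊗ₜ a'))) = _
    simp only [Φ0, LinearMap.comp_apply, LinearEquiv.coe_coe, lTensor_tmul, chiP, hf, coactT,
      TensorProduct.assoc_symm_tmul, TensorProduct.mk_apply, chi0, AlgebraTensorModule.curry_apply,
      LinearMap.restrictScalars_self, TensorProduct.curry_apply]
    induction δ.toLinearMap a' with
    | zero => simp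
    | add x y hx hy => simp only [tmul_add, map_add, hx, hy]
    | tmul d b => simp [tmulMap_tmul, hL a]
  have hbij : Function.Bijective (echi ∘ₗ (S.mkQ ∘ₗ Φ0)) := by
    rw [hcomp]
    rw [LinearMap.coe_comp]
    refine (TensorProduct.assoc k C A H).symm.bijective.comp ?_
    exact (TensorProduct.congr (LinearEquiv.refl k C) (LinearEquiv.ofBijective _ hgal)).bijective
  have hΦb : Function.Bijective (S.mkQ ∘ₗ Φ0) :=
    ⟨Function.Injective.of_comp (f := echi) (by simpa using hbij.1), hΦs⟩
  exact (Function.Bijective.of_comp_iff (f := echi) hΦb).1 (by simpa using hbij)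

theorem coassocT (hδ : IsComodAlg k A H δ) : Coassoc (coactT k A C H δ) := by
  unfold Coassoc
  ext c a
  have h := congrArg (fun z => (TensorProduct.assoc k C A (H ⊗[k] H)).symm ((c : C) ⊗ₜ[k] z))
    (LinearMap.congr_fun hδ.1 a)
  simp only [LinearMap.comp_apply, LinearEquiv.coe_coe, coactT, lTensor_tmul,
    AlgebraTensorModule.curry_apply,
      LinearMap.restrictScalars_self, TensorProduct.curry_apply] at h ⊢
  convert h using 1
  · induction δ.toLinearMap a with
    | zero => simp
    | add x y hx hy => simp only [tmul_add, map_add, hx, hy]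
    | tmul d b =>
      simp only [rTensor_tmul, TensorProduct.assoc_symm_tmul, LinearMap.comp_apply, lTensor_tmul,
        LinearEquiv.coe_coe]
      induction δ.toLinearMap d with
      | zero => simp
      | add x y hx hy => simp only [tmul_add, add_tmul, map_add, hx, hy]
      | tmul d b => simp
  · induction δ.toLinearMap a with
    | zero => simp
    | add x y hx hy => simp only [tmul_add, map_add, hx, hy]
    | tmul d b => simp

theorem counitT (hδ : IsComodAlg k A H δ) : Counital (coactT k A C H δ) := by
  unfold Counital
  ext c a
  have h := congrArg (fun z => (c : C) ⊗ₜ[k] z)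
    (LinearMap.congr_fun hδ.2 a)
  simp only [LinearMap.comp_apply, LinearEquiv.coe_coe, coactT, lTensor_tmul,
    AlgebraTensorModule.curry_apply,
      LinearMap.restrictScalars_self, TensorProduct.curry_apply] at h ⊢
  refine Eq.trans ?_ h
  induction δ.toLinearMap a with
  | zero => simp
  | add x y hx hy => simp only [tmul_add, map_add, hx, hy]
  | tmul d b => simp
end mult

section matched
variable {k : Type*} [Field k] {A : Type*} [Ring A] [Bialgebra k A]
    {C : Type*} [Ring C] [Bialgebra k C] {H : Type*} [Ring H] [HopfAlgebra k H]
    (r : A ⊗[k] C →ₗ[k] A) (l : A ⊗[k] C →ₗ[k] C)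

abbrev DD : A ⊗[k] C →ₗ[k] (A ⊗[k] C) ⊗[k] (A ⊗[k] C) :=
  (TensorProduct.tensorTensorTensorComm k A A C C).toLinearMap
          ∘ₗ TensorProduct.map (comul (R := k) (A := A)) (comul (R := k) (A := C))

theorem DD_coassoc (x : A ⊗[k] C) :
    TensorProduct.assoc k _ _ _ (rTensor _ DD (DD x)) = lTensor (A ⊗[k] C) DD (DD x) :=
  Coalgebra.coassoc_apply (R := k) (A := A ⊗[k] C) x

theorem leftN (hr2 : ∀ a : A, r (a ⊗ₜ (1 : C)) = a)
    (hc4 : ∀ a : A, l (a ⊗ₜ (1 : C)) = counit (R := k) a • (1 : C)) :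
    LeftNormal k A C (TensorProduct.map l r ∘ₗ DD) := by
  intro a
  have h := Coalgebra.rTensor_counit_comul (R := k) a
  have h' := congrArg (fun z => lTensor C (TensorProduct.lid k A).toLinearMap ((1 : C) ⊗ₜ[k] z)) h
  simp only [LinearMap.comp_apply, LinearEquiv.coe_coe, TensorProduct.map_tmul, DD,
    Bialgebra.comul_one] at h' ⊢
  convert h' using 1
  · induction comul (R := k) a with
    | zero => simp
    | add x y hx hy => simp only [tmul_add, add_tmul, map_add, hx, hy]
    | tmul d b => simp [Algebra.TensorProduct.one_def, hr2, hc4, smul_tmul]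
  · simp

theorem rightN (hl2 : ∀ c : C, l ((1 : A) ⊗ₜ c) = c)
    (hc2 : ∀ c : C, r ((1 : A) ⊗ₜ c) = counit (R := k) c • (1 : A)) :
    RightNormal k A C (TensorProduct.map l r ∘ₗ DD) := by
  intro a
  have h := Coalgebra.lTensor_counit_comul (R := k) a
  have h' := congrArg (fun z => (TensorProduct.rid k C z) ⊗ₜ[k] (1 : A)) h
  simp only [LinearMap.comp_apply, LinearEquiv.coe_coe, TensorProduct.map_tmul, DD,
    Bialgebra.comul_one] at h' ⊢
  convert h' using 1
  · induction comul (R := k) a with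
    | zero => simp
    | add x y hx hy => simp only [tmul_add, add_tmul, map_add, hx, hy]
    | tmul d b => simp [Algebra.TensorProduct.one_def, hl2, hc2, smul_tmul]
  · simp

theorem comodMor (δ : A →ₐ[k] A ⊗[k] H)
    (hΔcom : coactT k A A H δ ∘ₗ (comul (R := k) (A := A))
      = rTensor H (comul (R := k) (A := A)) ∘ₗ δ.toLinearMap)
    (hrcom : δ.toLinearMap ∘ₗ r
      = rTensor H r
          ∘ₗ (TensorProduct.assoc k A C H).symm.toLinearMap
          ∘ₗ lTensor A (TensorProduct.comm k H C).toLinearMap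
          ∘ₗ (TensorProduct.assoc k A H C).toLinearMap
          ∘ₗ rTensor C δ.toLinearMap) :
    IsComodMor k A C H δ (TensorProduct.map l r ∘ₗ DD) := by
  unfold IsComodMor
  ext a c
  -- the linear map `(A ⊗ A) ⊗ H → C ⊗ (A ⊗ H)` for fixed `c`
  let T : (A ⊗[k] A) ⊗[k] H →ₗ[k] C ⊗[k] (A ⊗[k] H) :=
    (TensorProduct.assoc k C A H).toLinearMap ∘ₗ rTensor H
      (TensorProduct.map l r ∘ₗ (TensorProduct.tensorTensorTensorComm k A A C C).toLinearMap ∘ₗ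
        (TensorProduct.mk k _ _).flip (comul (R := k) c))
  have h := congrArg T (LinearMap.congr_fun hΔcom a)
  simp only [LinearMap.comp_apply, LinearEquiv.coe_coe, TensorProduct.map_tmul, DD,
    AlgebraTensorModule.curry_apply, lTensor_tmul, rTensor_tmul,
      LinearMap.restrictScalars_self, TensorProduct.curry_apply] at h ⊢
  convert h using 1
  · induction comul (R := k) a with
    | zero => simp
    | add x y hx hy => simp only [tmul_add, add_tmul, map_add, hx, hy]
    | tmul d b =>
      simp only [T, LinearMap.comp_apply, LinearEquiv.coe_coe, coactT, lTensor_tmul]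
      rw [← sub_eq_zero]
      have key : ∀ w : C ⊗[k] C,
        lTensor C δ.toLinearMap (TensorProduct.map l r
          (TensorProduct.tensorTensorTensorComm k A A C C ((d ⊗ₜ b) ⊗ₜ w))) =
        TensorProduct.assoc k C A H (rTensor H
          (TensorProduct.map l r ∘ₗ (TensorProduct.tensorTensorTensorComm k A A C C).toLinearMap ∘ₗ
            (TensorProduct.mk k _ _).flip w)
            ((TensorProduct.assoc k A A H).symm (d ⊗ₜ δ.toLinearMap b))) := by
        intro w
        induction w with
        | zero => simp
        | add x y hx hy =>
          simp only [tmul_add, add_tmul, map_add, hx, hy, LinearMap.comp_add, rTensor_add,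
            LinearMap.add_apply]
        | tmul p q =>
          have h3 := LinearMap.congr_fun hrcom (b ⊗ₜ q)
          simp only [LinearMap.comp_apply, LinearEquiv.coe_coe, rTensor_tmul] at h3
          simp only [TensorProduct.tensorTensorTensorComm_tmul, TensorProduct.map_tmul,
            lTensor_tmul]
          rw [h3]
          induction δ.toLinearMap b with
          | zero => simp
          | add x y hx hy => simp only [tmul_add, add_tmul, map_add, hx, hy]
          | tmul d b => simp
      rw [sub_eq_zero]
      exact key _
  · simp only [T]
    induction δ.toLinearMap a with
    | zero => simp
    | add x y hx hy => simp only [tmul_add, add_tmul, map_add, hx, hy]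
    | tmul d b => simp

theorem distC2
    (hr1 : r ∘ₗ lTensor A (LinearMap.mul' k C)
      = r ∘ₗ rTensor C r ∘ₗ (TensorProduct.assoc k A C C).symm.toLinearMap)
    (hrΔ : comul ∘ₗ r = TensorProduct.map r r ∘ₗ DD)
    (hc3 : l ∘ₗ lTensor A (LinearMap.mul' k C)
      = LinearMap.mul' k C
          ∘ₗ TensorProduct.map l (l ∘ₗ rTensor C r)
          ∘ₗ (TensorProduct.assoc k (A ⊗[k] C) (A ⊗[k] C) C).toLinearMap
          ∘ₗ rTensor C DD
          ∘ₗ (TensorProduct.assoc k A C C).symm.toLinearMap)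
    (a : A) (c c' : C) :
    (TensorProduct.map l r ∘ₗ DD) (a ⊗ₜ (c * c')) =
      tmulMap k A C (TensorProduct.map l r ∘ₗ DD)
        ((TensorProduct.map l r ∘ₗ DD) (a ⊗ₜ c) ⊗ₜ (c' ⊗ₜ 1)) := by
  -- `G w (u ⊗ (v ⊗ z)) = l u * l (r v ⊗ w₁) ⊗ r (r z ⊗ w₂)`
  let K : C ⊗[k] C →ₗ[k] (A ⊗[k] A) →ₗ[k] C ⊗[k] A :=
    (TensorProduct.mk k (A ⊗[k] A) (C ⊗[k] C)).flip.compr₂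
      (TensorProduct.map l r ∘ₗ (TensorProduct.tensorTensorTensorComm k A A C C).toLinearMap)
  have hK : ∀ w z, K w z = TensorProduct.map l r
      (TensorProduct.tensorTensorTensorComm k A A C C (z ⊗ₜ w)) := fun w z => rfl
  let mm : C ⊗[k] (C ⊗[k] A) →ₗ[k] C ⊗[k] A :=
    rTensor A (LinearMap.mul' k C) ∘ₗ (TensorProduct.assoc k C C A).symm.toLinearMap
  let G : C ⊗[k] C → (A ⊗[k] C) ⊗[k] ((A ⊗[k] C) ⊗[k] (A ⊗[k] C)) →ₗ[k] C ⊗[k] A := fun w =>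
    mm ∘ₗ TensorProduct.map l (K w ∘ₗ TensorProduct.map r r)
  have hG : ∀ w w', G (w + w') = G w + G w' := by
    intro w w'
    simp only [G, map_add, LinearMap.add_comp, TensorProduct.map_add_right, LinearMap.comp_add]
  -- left side
  have L : ∀ (u : A ⊗[k] A) (v w : C ⊗[k] C),
      TensorProduct.map l r (TensorProduct.tensorTensorTensorComm k A A C C (u ⊗ₜ (v * w))) =
      G w (TensorProduct.assoc k _ _ _ (rTensor _ DD
        (TensorProduct.tensorTensorTensorComm k A A C C (u ⊗ₜ v)))) := by
    intro u v w
    induction u with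
    | zero => simp
    | add x y hx hy => simp only [add_tmul, map_add, hx, hy]
    | tmul a1 a2 =>
    induction v with
    | zero => simp
    | add x y hx hy => simp only [add_mul, tmul_add, map_add, hx, hy]
    | tmul c1 c2 =>
    induction w with
    | zero => simp [G]
    | add x y hx hy => simp only [mul_add, tmul_add, map_add, hx, hy, hG, LinearMap.add_apply]
    | tmul p q =>
      have h1 := LinearMap.congr_fun hr1 (a2 ⊗ₜ (c2 ⊗ₜ q))
      have h3 := LinearMap.congr_fun hc3 (a1 ⊗ₜ (c1 ⊗ₜ p))
      simp only [LinearMap.comp_apply, LinearEquiv.coe_coe, rTensor_tmul, lTensor_tmul,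
        LinearMap.mul'_apply, TensorProduct.assoc_symm_tmul] at h1 h3
      simp only [Algebra.TensorProduct.tmul_mul_tmul, TensorProduct.tensorTensorTensorComm_tmul,
        TensorProduct.map_tmul, rTensor_tmul]
      rw [h1, h3]
      change _ = G (p ⊗ₜ q) (TensorProduct.assoc k _ _ _ (DD (a1 ⊗ₜ c1) ⊗ₜ (a2 ⊗ₜ c2)))
      change (LinearMap.mul' k C ((TensorProduct.map l (l ∘ₗ rTensor C r))
        (TensorProduct.assoc k _ _ _ (DD (a1 ⊗ₜ c1) ⊗ₜ p)))) ⊗ₜ _ = _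
      induction DD (a1 ⊗ₜ[k] c1) with
      | zero => simp
      | add x y hx hy => simp only [tmul_add, add_tmul, map_add, hx, hy]
      | tmul d b => simp [G, mm, hK]
  have R : ∀ z : (A ⊗[k] C) ⊗[k] (A ⊗[k] C),
      tmulMap k A C (TensorProduct.map l r ∘ₗ DD) (TensorProduct.map l r z ⊗ₜ (c' ⊗ₜ 1)) =
      G (comul c') (lTensor _ DD z) := by
    intro z
    induction z with
    | zero => simp
    | add x y hx hy => simp only [add_tmul, map_add, hx, hy]
    | tmul x y =>
      have h := LinearMap.congr_fun hrΔ y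
      rw [TensorProduct.map_tmul, tmulMap_tmul]
      simp only [lTensor_tmul, G, LinearMap.comp_apply, TensorProduct.map_tmul] at h ⊢
      change _ = mm (l x ⊗ₜ K (comul c') (TensorProduct.map r r (DD y)))
      change comul (r y) = TensorProduct.map r r (DD y) at h
      rw [← h, hK]
      simp only [LinearEquiv.coe_coe, LinearMap.mulRight_one]
      induction TensorProduct.map l r (TensorProduct.tensorTensorTensorComm k A A C C
        (comul (r y) ⊗ₜ comul c')) with
      | zero => simp
      | add x y hx hy => simp only [tmul_add, map_add, hx, hy]
      | tmul d b => simp [mm]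
  have e1 : (TensorProduct.map l r ∘ₗ DD) (a ⊗ₜ (c * c')) =
      TensorProduct.map l r (TensorProduct.tensorTensorTensorComm k A A C C
        (comul a ⊗ₜ (comul c * comul c'))) := by
    rw [← Bialgebra.comul_mul]; rfl
  rw [e1, L]
  have e2 := DD_coassoc (k := k) (a ⊗ₜ[k] c)
  have e3 := R (DD (a ⊗ₜ[k] c))
  rw [← e2] at e3
  exact e3.symm
end matched
end DCP

open Paper Coalgebra in
/-- for a matched pair of bialgebras `{C, A}` with `A` a faithfully flat
`H`-Galois object such that `Δ_A` and `◁` are `H`-comodule morphisms, the double crossed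
product `C ⋈ A` (the twisted tensor product along `ψ(a ⊗ c) = (a₁ ▷ c₁) ⊗ (a₂ ◁ c₂)`) is a
faithfully flat `H`-Galois extension of `C`. -/
theorem doubleCrossedProduct_HopfGalois
    (k : Type*) [Field k] (A : Type*) [Ring A] [Bialgebra k A]
    (C : Type*) [Ring C] [Bialgebra k C] (H : Type*) [Ring H] [HopfAlgebra k H]
    -- the matched pair structure: `r = ◁ : A ⊗ C → A` and `l = ▷ : A ⊗ C → C`
    (r : A ⊗[k] C →ₗ[k] A) (l : A ⊗[k] C →ₗ[k] C)
    -- `(A, ◁)` is a right `C`-module: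
    (hr1 : r ∘ₗ lTensor A (LinearMap.mul' k C)
      = r ∘ₗ rTensor C r ∘ₗ (TensorProduct.assoc k A C C).symm.toLinearMap)
    (hr2 : ∀ a : A, r (a ⊗ₜ (1 : C)) = a)
    -- and a `C`-module coalgebra:
    (hrΔ : comul ∘ₗ r
      = TensorProduct.map r r
          ∘ₗ (TensorProduct.tensorTensorTensorComm k A A C C).toLinearMap
          ∘ₗ TensorProduct.map (comul (R := k) (A := A)) (comul (R := k) (A := C)))
    (hrε : counit ∘ₗ r
      = (TensorProduct.lid k k).toLinearMap
          ∘ₗ TensorProduct.map (counit (R := k) (A := A)) (counit (R := k) (A := C)))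
    -- `(C, ▷)` is a left `A`-module:
    (hl1 : l ∘ₗ rTensor C (LinearMap.mul' k A)
      = l ∘ₗ lTensor A l ∘ₗ (TensorProduct.assoc k A A C).toLinearMap)
    (hl2 : ∀ c : C, l ((1 : A) ⊗ₜ c) = c)
    -- and an `A`-module coalgebra:
    (hlΔ : comul ∘ₗ l
      = TensorProduct.map l l
          ∘ₗ (TensorProduct.tensorTensorTensorComm k A A C C).toLinearMap
          ∘ₗ TensorProduct.map (comul (R := k) (A := A)) (comul (R := k) (A := C)))
    (hlε : counit ∘ₗ l
      = (TensorProduct.lid k k).toLinearMap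
          ∘ₗ TensorProduct.map (counit (R := k) (A := A)) (counit (R := k) (A := C)))
    -- compatibility `(aa') ◁ c = (a ◁ (a'₁ ▷ c₁))(a'₂ ◁ c₂)`:
    (hc1 : r ∘ₗ rTensor C (LinearMap.mul' k A)
      = LinearMap.mul' k A
          ∘ₗ TensorProduct.map (r ∘ₗ lTensor A l) r
          ∘ₗ (TensorProduct.assoc k A (A ⊗[k] C) (A ⊗[k] C)).symm.toLinearMap
          ∘ₗ lTensor A ((TensorProduct.tensorTensorTensorComm k A A C C).toLinearMap
              ∘ₗ TensorProduct.map (comul (R := k) (A := A)) (comul (R := k) (A := C)))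
          ∘ₗ (TensorProduct.assoc k A A C).toLinearMap)
    -- compatibility `1_A ◁ c = ε_C(c) 1_A`:
    (hc2 : ∀ c : C, r ((1 : A) ⊗ₜ c) = counit (R := k) c • (1 : A))
    -- compatibility `a ▷ (cc') = (a₁ ▷ c₁)((a₂ ◁ c₂) ▷ c')`:
    (hc3 : l ∘ₗ lTensor A (LinearMap.mul' k C)
      = LinearMap.mul' k C
          ∘ₗ TensorProduct.map l (l ∘ₗ rTensor C r)
          ∘ₗ (TensorProduct.assoc k (A ⊗[k] C) (A ⊗[k] C) C).toLinearMap
          ∘ₗ rTensor C ((TensorProduct.tensorTensorTensorComm k A A C C).toLinearMap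
              ∘ₗ TensorProduct.map (comul (R := k) (A := A)) (comul (R := k) (A := C)))
          ∘ₗ (TensorProduct.assoc k A C C).symm.toLinearMap)
    -- compatibility `a ▷ 1_C = ε_A(a) 1_C`:
    (hc4 : ∀ a : A, l (a ⊗ₜ (1 : C)) = counit (R := k) a • (1 : C))
    -- compatibility `(a₁ ◁ c₁) ⊗ (a₂ ▷ c₂) = (a₂ ◁ c₂) ⊗ (a₁ ▷ c₁)`:
    (hc5 : TensorProduct.map r l
        ∘ₗ (TensorProduct.tensorTensorTensorComm k A A C C).toLinearMap
        ∘ₗ TensorProduct.map (comul (R := k) (A := A)) (comul (R := k) (A := C))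
      = TensorProduct.map r l
          ∘ₗ (TensorProduct.comm k (A ⊗[k] C) (A ⊗[k] C)).toLinearMap
          ∘ₗ (TensorProduct.tensorTensorTensorComm k A A C C).toLinearMap
          ∘ₗ TensorProduct.map (comul (R := k) (A := A)) (comul (R := k) (A := C)))
    -- `A` is a faithfully flat `H`-Galois object:
    (δ : A →ₐ[k] A ⊗[k] H) (hδ : IsComodAlg k A H δ)
    (hco : coinv k A H δ = ⊥)
    (hgal : Function.Bijective (chi0 k A H δ))
    (hff : Module.FaithfullyFlat k A)
    -- `Δ_A` is an `H`-comodule morphism: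
    (hΔcom : coactT k A A H δ ∘ₗ (comul (R := k) (A := A))
      = rTensor H (comul (R := k) (A := A)) ∘ₗ δ.toLinearMap)
    -- `◁` is an `H`-comodule morphism:
    (hrcom : δ.toLinearMap ∘ₗ r
      = rTensor H r
          ∘ₗ (TensorProduct.assoc k A C H).symm.toLinearMap
          ∘ₗ lTensor A (TensorProduct.comm k H C).toLinearMap
          ∘ₗ (TensorProduct.assoc k A H C).toLinearMap
          ∘ₗ rTensor C δ.toLinearMap) :
    -- then, for the twisting map `ψ(a ⊗ c) = (a₁ ▷ c₁) ⊗ (a₂ ◁ c₂)` of the double crossed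
    -- product `C ⋈ A`:
    ∀ ψ : A ⊗[k] C →ₗ[k] C ⊗[k] A,
      ψ = TensorProduct.map l r
            ∘ₗ (TensorProduct.tensorTensorTensorComm k A A C C).toLinearMap
            ∘ₗ TensorProduct.map (comul (R := k) (A := A)) (comul (R := k) (A := C)) →
      -- `C ⋈ A = C ⊗^ψ A` is a right `H`-comodule algebra:
      ((∀ x y : C ⊗[k] A,
          coactT k A C H δ (tmul k A C ψ x y)
            = tmulH (TensorProduct.curry (tmulMap k A C ψ))
                (coactT k A C H δ x) (coactT k A C H δ y))
        ∧ coactT k A C H δ ((1 : C) ⊗ₜ (1 : A)) = ((1 : C) ⊗ₜ (1 : A)) ⊗ₜ (1 : H)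
        ∧ Coassoc (coactT k A C H δ) ∧ Counital (coactT k A C H δ))
      -- whose coinvariant subalgebra is `C ⊗ 1_A ≅ C`:
      ∧ {x : C ⊗[k] A | coactT k A C H δ x = x ⊗ₜ (1 : H)}
          = Set.range (fun c : C => c ⊗ₜ (1 : A))
      -- and `C ⊆ C ⋈ A` is an `H`-Galois extension:
      ∧ (∃ echi : (((C ⊗[k] A) ⊗[k] (C ⊗[k] A)) ⧸
            balSpan (TensorProduct.curry (tmulMap k A C ψ)) (fun c : C => c ⊗ₜ (1 : A)))
              →ₗ[k] (C ⊗[k] A) ⊗[k] H,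
          (∀ z, echi ((balSpan (TensorProduct.curry (tmulMap k A C ψ))
              (fun c : C => c ⊗ₜ (1 : A))).mkQ z)
            = chiP (TensorProduct.curry (tmulMap k A C ψ)) (coactT k A C H δ) z)
          ∧ Function.Bijective echi)
      -- which is faithfully flat as a left `C`-module:
      ∧ IsFaithfullyFlatLeft C (C ⊗[k] A) := by
  intro ψ hψ
  subst hψ
  have hL := DCP.leftN r l hr2 hc4
  have hR := DCP.rightN r l hl2 hc2
  have h2 := DCP.distC2 r l hr1 hrΔ hc3
  have hm := DCP.comodMor r l δ hΔcom hrcom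
  have : Nontrivial A := (TensorProduct.lid k A).symm.toEquiv.nontrivial
  refine ⟨⟨DCP.coact_mul _ δ hm, ?_, DCP.coassocT δ hδ, DCP.counitT δ hδ⟩,
    DCP.coinv_tensor k A C H δ hco, DCP.galois _ δ hL hR h2 hgal, DCP.ff_left k A C⟩
  simp [coactT, Algebra.TensorProduct.one_def]
end
end
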